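/- Under hypotheses (H1)–(H4), with d = |K ∩ H⁺|^{1/n} − ((n/(n+1))ⁿ)^{1/n}, one has ∫_ℝ |c(x)^{n−1} − s(x)^{n−1}| dx ≤ 64·3^{n+2}·n^{n+2}·d^{1/(2n)}, where c and s are extended by 0 outside their original domains. -/

import Mathlib

open MeasureTheory Set

section BM

lemma bm1_compact (A B : Set ℝ) (hA : IsCompact A) (hB : IsCompact B) (hA0 : A.Nonempty)
    (hB0 : B.Nonempty) (S : Set ℝ) (hS : ∀ x ∈ A, ∀ y ∈ B, x + y ∈ S) :
    volume A + volume B ≤ volume S := by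
  obtain ⟨α, hα⟩ := hA.exists_isGreatest hA0
  obtain ⟨β, hβ⟩ := hB.exists_isLeast hB0
  have e1 : volume A = volume ((fun x => x + β) '' A) := by simp
  have e2 : volume B = volume ((fun x => α + x) '' B) := by simp
  have hm : MeasurableSet ((fun x => α + x) '' B) :=
    (hB.image (by fun_prop)).measurableSet
  have hd : AEDisjoint volume ((fun x => x + β) '' A) ((fun x => α + x) '' B) := by
    refine measure_mono_null (t := {α + β}) ?_ (by simp)
    rintro z ⟨⟨x, hx, rfl⟩, ⟨y, hy, h⟩⟩
    have h1 := hα.2 hx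
    have h2 := hβ.2 hy
    simp only at h
    simp only [mem_singleton_iff]
    linarith
  rw [e1, e2, ← measure_union₀ hm.nullMeasurableSet hd]
  apply measure_mono
  rintro z (⟨x, hx, rfl⟩ | ⟨y, hy, rfl⟩)
  · exact hS _ hx _ hβ.1
  · exact hS _ hα.1 _ hy

lemma bm1 (A B : Set ℝ) (hA : MeasurableSet A) (hB : MeasurableSet B) (hA0 : A.Nonempty)
    (hB0 : B.Nonempty) (S : Set ℝ) (hS : ∀ x ∈ A, ∀ y ∈ B, x + y ∈ S) :
    volume A + volume B ≤ volume S := by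
  obtain ⟨α, hα⟩ := hA0
  obtain ⟨β, hβ⟩ := hB0
  have key : ∀ K ⊆ A, IsCompact K → ∀ L ⊆ B, IsCompact L → volume K + volume L ≤ volume S := by
    intro K hK hKc L hL hLc
    calc volume K + volume L ≤ volume (insert α K) + volume (insert β L) := by
          gcongr <;> exact subset_insert _ _
      _ ≤ _ := bm1_compact _ _ (hKc.insert _) (hLc.insert _) (insert_nonempty _ _)
          (insert_nonempty _ _) S
          (fun x hx y hy => hS x (insert_subset hα hK hx) y (insert_subset hβ hL hy))
  rw [hA.measure_eq_iSup_isCompact, hB.measure_eq_iSup_isCompact]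
  simp only [iSup_and']
  exact ENNReal.biSup_add_biSup_le' ⟨∅, by simp⟩ ⟨∅, by simp⟩
    (fun K hK L hL => key K hK.1 hK.2 L hL.1 hL.2)

lemma pl1_norm (t : ℝ) (ht0 : 0 < t) (ht1 : t < 1) (f g h : ℝ → ℝ) (hf : Measurable f)
    (hg : Measurable g) (hh : Measurable h) (f0 : ∀ x, 0 ≤ f x) (g0 : ∀ x, 0 ≤ g x)
    (h0 : ∀ x, 0 ≤ h x)
    (f1 : ∀ x, f x ≤ 1) (g1 : ∀ x, g x ≤ 1) (fs : ∀ s < 1, ∃ x, s < f x)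
    (gs : ∀ s < 1, ∃ x, s < g x)
    (H : ∀ s, 0 < s → s < 1 → ∀ x y, s < f x → s < g y → s < h ((1 - t) * x + t * y)) :
    ENNReal.ofReal (1 - t) * (∫⁻ x, ENNReal.ofReal (f x)) +
      ENNReal.ofReal t * (∫⁻ x, ENNReal.ofReal (g x)) ≤ ∫⁻ x, ENNReal.ofReal (h x) := by
  rw [lintegral_eq_lintegral_meas_lt volume (ae_of_all _ f0) hf.aemeasurable,
    lintegral_eq_lintegral_meas_lt volume (ae_of_all _ g0) hg.aemeasurable,
    lintegral_eq_lintegral_meas_lt volume (ae_of_all _ h0) hh.aemeasurable]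
  have mono : ∀ u : ℝ → ℝ, Measurable (fun s => volume {a : ℝ | s < u a}) := fun u =>
    Antitone.measurable (fun x y hxy => measure_mono fun a (ha : y < u a) => lt_of_le_of_lt hxy ha)
  rw [← lintegral_const_mul _ (mono f), ← lintegral_const_mul _ (mono g),
    ← lintegral_add_left ((mono f).const_mul _)]
  refine setLIntegral_mono (mono h) ?_
  intro s hs
  have hs : 0 < s := hs
  by_cases hs1 : s < 1
  · have e1 : ENNReal.ofReal (1 - t) * volume {a | s < f a}
        = volume ((fun x => (1 - t) • x) '' {a | s < f a}) := by
      rw [image_smul, Measure.addHaar_smul_of_nonneg _ (by linarith)]; simp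
    have e2 : ENNReal.ofReal t * volume {a | s < g a}
        = volume ((fun x => t • x) '' {a | s < g a}) := by
      rw [image_smul, Measure.addHaar_smul_of_nonneg _ (by linarith)]; simp
    rw [e1, e2]
    apply bm1
    · rw [image_smul]
      exact (measurableSet_lt measurable_const hf).const_smul_of_ne_zero (by linarith)
    · rw [image_smul]
      exact (measurableSet_lt measurable_const hg).const_smul_of_ne_zero (by linarith)
    · exact Set.Nonempty.image _ (fs s hs1)
    · exact Set.Nonempty.image _ (gs s hs1)
    · rintro _ ⟨x, hx, rfl⟩ _ ⟨y, hy, rfl⟩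
      exact H s hs hs1 x y hx hy
  · have : {a | s < f a} = ∅ := by
      ext x; simp; linarith [f1 x]
    have : {a | s < g a} = ∅ := by
      ext x; simp; linarith [g1 x]
    simp [*]

open scoped ENNReal NNReal Pointwise

lemma ennreal_amgm (t : ℝ) (ht0 : 0 < t) (ht1 : t < 1) (a b : ℝ≥0∞) :
    a ^ (1 - t) * b ^ t ≤ ENNReal.ofReal (1 - t) * a + ENNReal.ofReal t * b := by
  have h1 : ENNReal.ofReal (1 - t) ≠ 0 := by simp; linarith
  have h2 : ENNReal.ofReal t ≠ 0 := by simp; linarith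
  by_cases ha : a = ⊤
  · simp [ha, ENNReal.mul_top h1]
  by_cases hb : b = ⊤
  · simp [hb, ENNReal.mul_top h2]
  lift a to ℝ≥0 using ha
  lift b to ℝ≥0 using hb
  have := NNReal.geom_mean_le_arith_mean2_weighted (Real.toNNReal (1 - t)) (Real.toNNReal t) a b
    (by rw [← Real.toNNReal_add (by linarith) (by linarith)]; simp)
  rw [Real.coe_toNNReal _ (by linarith), Real.coe_toNNReal _ (by linarith)] at this
  rw [← ENNReal.coe_rpow_of_nonneg _ (by linarith), ← ENNReal.coe_rpow_of_nonneg _ (by linarith)]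
  simp only [ENNReal.ofReal]
  exact_mod_cast this

lemma pl1_bdd (t : ℝ) (ht0 : 0 < t) (ht1 : t < 1) (f g h : ℝ → ℝ≥0∞) (hf : Measurable f)
    (hg : Measurable g) (hh : Measurable h) (M : ℝ≥0∞) (hM : M ≠ ⊤) (fM : ∀ x, f x ≤ M)
    (gM : ∀ x, g x ≤ M)
    (H : ∀ x y, f x ^ (1 - t) * g y ^ t ≤ h ((1 - t) * x + t * y)) :
    (∫⁻ x, f x) ^ (1 - t) * (∫⁻ x, g x) ^ t ≤ ∫⁻ x, h x := by
  have ht2 : 0 < 1 - t := by linarith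
  set A := ⨆ x, f x with hA
  set B := ⨆ x, g x with hB
  by_cases hA0 : A = 0
  · have : ∀ x, f x = 0 := by simpa [hA] using hA0
    simp [this, ht2]
  by_cases hB0 : B = 0
  · have : ∀ x, g x = 0 := by simpa [hB] using hB0
    simp [this, ht0]
  have hAt : A ≠ ⊤ := ne_top_of_le_ne_top hM (iSup_le fM)
  have hBt : B ≠ ⊤ := ne_top_of_le_ne_top hM (iSup_le gM)
  have fA : ∀ x, f x / A ≤ 1 := fun x => ENNReal.div_le_of_le_mul (by rw [one_mul]; exact le_iSup f x)
  have gB : ∀ x, g x / B ≤ 1 := fun x => ENNReal.div_le_of_le_mul (by rw [one_mul]; exact le_iSup g x)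
  set c := A ^ (1 - t) * B ^ t with hc
  have hAp : A ^ (1 - t) ≠ 0 := by simp [hA0, hAt]
  have hBp : B ^ t ≠ 0 := by simp [hB0, hBt]
  have hAq : A ^ (1 - t) ≠ ⊤ := ENNReal.rpow_ne_top_of_nonneg ht2.le hAt
  have hBq : B ^ t ≠ ⊤ := ENNReal.rpow_ne_top_of_nonneg ht0.le hBt
  have hc0 : c ≠ 0 := mul_ne_zero hAp hBp
  have hct : c ≠ ⊤ := ENNReal.mul_ne_top hAq hBq
  have split : ∀ u v : ℝ≥0∞, (u / A) ^ (1 - t) * (v / B) ^ t = u ^ (1 - t) * v ^ t / c := by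
    intro u v
    rw [ENNReal.div_rpow_of_nonneg _ _ ht2.le, ENNReal.div_rpow_of_nonneg _ _ ht0.le, hc,
      div_eq_mul_inv, div_eq_mul_inv, div_eq_mul_inv,
      ENNReal.mul_inv (Or.inl hAp) (Or.inl hAq)]
    ring
  have toR : ∀ p : ℝ≥0∞, p ≤ 1 → ENNReal.ofReal p.toReal = p := fun p hp =>
    ENNReal.ofReal_toReal (ne_top_of_le_ne_top ENNReal.one_ne_top hp)
  have ltR : ∀ (p : ℝ≥0∞) (s : ℝ), 0 < s → p ≤ 1 → (s < p.toReal ↔ ENNReal.ofReal s < p) := by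
    intro p s hs hp
    rw [ENNReal.ofReal_lt_iff_lt_toReal hs.le (ne_top_of_le_ne_top ENNReal.one_ne_top hp)]
  have key := pl1_norm t ht0 ht1 (fun x => (f x / A).toReal) (fun x => (g x / B).toReal)
    (fun x => (min (h x / c) 1).toReal) (hf.div_const _).ennreal_toReal
    (hg.div_const _).ennreal_toReal ((hh.div_const _).min measurable_const).ennreal_toReal
    (fun _ => ENNReal.toReal_nonneg) (fun _ => ENNReal.toReal_nonneg)
    (fun _ => ENNReal.toReal_nonneg)
    (fun x => ENNReal.toReal_le_of_le_ofReal zero_le_one (by simpa using fA x))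
    (fun x => ENNReal.toReal_le_of_le_ofReal zero_le_one (by simpa using gB x))
    ?_ ?_ ?_
  · simp only [toR _ (fA _), toR _ (gB _), toR _ (min_le_right _ _)] at key
    have k2 : ∫⁻ x, min (h x / c) 1 ≤ (∫⁻ x, h x) / c := by
      rw [div_eq_mul_inv, ← lintegral_mul_const _ hh]
      exact lintegral_mono fun x => min_le_left _ _
    have k3 := (ennreal_amgm t ht0 ht1 _ _).trans (key.trans k2)
    simp only [div_eq_mul_inv] at k3
    rw [lintegral_mul_const _ hf, lintegral_mul_const _ hg] at k3
    simp only [← div_eq_mul_inv] at k3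
    rw [split] at k3
    rw [ENNReal.div_le_iff hc0 hct, ENNReal.div_mul_cancel hc0 hct] at k3
    exact k3
  · intro s hs
    by_cases hs0 : 0 < s
    · by_contra! hcon
      have : A ≤ ENNReal.ofReal s * A := iSup_le fun x => by
        have := (not_lt.2 (hcon x))
        rw [ltR _ _ hs0 (fA x), not_lt, ENNReal.div_le_iff hA0 hAt] at this
        exact this
      have h3 : ENNReal.ofReal s * A < 1 * A :=
        ENNReal.mul_lt_mul_left hA0 hAt (by simpa using hs)
      rw [one_mul] at h3
      exact absurd this (not_le.2 h3)
    · obtain ⟨x, hx⟩ : ∃ x, f x ≠ 0 := by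
        by_contra! hcon
        exact hA0 (by simp [hA, hcon])
      exact ⟨x, lt_of_le_of_lt (not_lt.1 hs0) (ENNReal.toReal_pos (by simp [hx, hAt])
        (ne_top_of_le_ne_top ENNReal.one_ne_top (fA x)))⟩
  · intro s hs
    by_cases hs0 : 0 < s
    · by_contra! hcon
      have : B ≤ ENNReal.ofReal s * B := iSup_le fun x => by
        have := (not_lt.2 (hcon x))
        rw [ltR _ _ hs0 (gB x), not_lt, ENNReal.div_le_iff hB0 hBt] at this
        exact this
      have h3 : ENNReal.ofReal s * B < 1 * B :=
        ENNReal.mul_lt_mul_left hB0 hBt (by simpa using hs)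
      rw [one_mul] at h3
      exact absurd this (not_le.2 h3)
    · obtain ⟨x, hx⟩ : ∃ x, g x ≠ 0 := by
        by_contra! hcon
        exact hB0 (by simp [hB, hcon])
      exact ⟨x, lt_of_le_of_lt (not_lt.1 hs0) (ENNReal.toReal_pos (by simp [hx, hBt])
        (ne_top_of_le_ne_top ENNReal.one_ne_top (gB x)))⟩
  · intro s hs0 hs1 x y hx hy
    rw [ltR _ _ hs0 (fA x)] at hx
    rw [ltR _ _ hs0 (gB y)] at hy
    rw [ltR _ _ hs0 (min_le_right _ _)]
    refine lt_min ?_ (by simpa using hs1)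
    have e : ENNReal.ofReal s = ENNReal.ofReal s ^ (1 - t) * ENNReal.ofReal s ^ t := by
      rw [← ENNReal.rpow_add _ _ (by simpa using hs0) (by simp)]; simp
    calc ENNReal.ofReal s = _ := e
      _ < (f x / A) ^ (1 - t) * (g y / B) ^ t :=
        ENNReal.mul_lt_mul (ENNReal.rpow_lt_rpow hx ht2) (ENNReal.rpow_lt_rpow hy ht0)
      _ = f x ^ (1 - t) * g y ^ t / c := split _ _
      _ ≤ _ := ENNReal.div_le_div_right (H x y) _

lemma pl1 (t : ℝ) (ht0 : 0 < t) (ht1 : t < 1) (f g h : ℝ → ℝ≥0∞) (hf : Measurable f)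
    (hg : Measurable g) (hh : Measurable h)
    (H : ∀ x y, f x ^ (1 - t) * g y ^ t ≤ h ((1 - t) * x + t * y)) :
    (∫⁻ x, f x) ^ (1 - t) * (∫⁻ x, g x) ^ t ≤ ∫⁻ x, h x := by
  have ht2 : 0 < 1 - t := by linarith
  by_cases hA0 : ∫⁻ x, f x = 0
  · simp [hA0, ht2]
  by_cases hB0 : ∫⁻ x, g x = 0
  · simp [hB0, ht0]
  have lim : ∀ u : ℝ → ℝ≥0∞, Measurable u → Filter.Tendsto (fun N : ℕ => ∫⁻ x, min (u x) N)
      Filter.atTop (nhds (∫⁻ x, u x)) := by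
    intro u hu
    refine lintegral_tendsto_of_tendsto_of_monotone
      (fun N => (hu.min measurable_const).aemeasurable) (ae_of_all _ fun x N N' hN => ?_)
      (ae_of_all _ fun x => ?_)
    · exact min_le_min_left _ (by exact_mod_cast hN)
    · have : Filter.Tendsto (fun N : ℕ => min (u x) (N : ℝ≥0∞)) Filter.atTop
        (nhds (min (u x) ⊤)) := tendsto_const_nhds.min ENNReal.tendsto_nat_nhds_top
      simpa using this
  have l1 := ENNReal.Tendsto.mul ((lim f hf).ennrpow_const (1 - t)) (Or.inl (by
    simp only [ne_eq, ENNReal.rpow_eq_zero_iff, not_or, not_and, not_lt]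
    exact ⟨fun h => absurd h hA0, fun _ => ht2.le⟩))
    ((lim g hg).ennrpow_const t) (Or.inl (by
    simp only [ne_eq, ENNReal.rpow_eq_zero_iff, not_or, not_and, not_lt]
    exact ⟨fun h => absurd h hB0, fun _ => ht0.le⟩))
  refine le_of_tendsto' l1 fun N => ?_
  refine pl1_bdd t ht0 ht1 _ _ h (hf.min measurable_const) (hg.min measurable_const) hh N
    (by simp) (fun x => min_le_right _ _) (fun x => min_le_right _ _) fun x y => ?_
  refine le_trans ?_ (H x y)
  gcongr
  · exact min_le_left _ _
  · exact min_le_left _ _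

lemma pl (m : ℕ) (t : ℝ) (ht0 : 0 < t) (ht1 : t < 1) (f g h : (Fin m → ℝ) → ℝ≥0∞)
    (hf : Measurable f) (hg : Measurable g) (hh : Measurable h)
    (H : ∀ x y, f x ^ (1 - t) * g y ^ t ≤ h ((1 - t) • x + t • y)) :
    (∫⁻ x, f x) ^ (1 - t) * (∫⁻ x, g x) ^ t ≤ ∫⁻ x, h x := by
  induction m with
  | zero =>
    have e : ∀ u : (Fin 0 → ℝ) → ℝ≥0∞, ∫⁻ x, u x = u default := by
      intro u
      rw [lintegral_unique, volume_pi, Measure.pi_of_empty _ default]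
      simp only [measure_univ, mul_one, lintegral_dirac]
      exact congrArg u (Subsingleton.elim _ _)
    rw [e, e, e]
    have := H default default
    rwa [Subsingleton.elim ((1 - t) • (default : Fin 0 → ℝ) + t • default) default] at this
  | succ m ih =>
    have mc : ∀ x : ℝ, Measurable (fun y : Fin m → ℝ => (Fin.cons x y : Fin (m + 1) → ℝ)) := by
      intro x
      refine measurable_pi_iff.2 fun i => ?_
      refine Fin.cases ?_ (fun j => ?_) i
      · simp
      · simp only [Fin.cons_succ]
        exact measurable_pi_apply j
    have mc2 : Measurable (fun p : ℝ × (Fin m → ℝ) => (Fin.cons p.1 p.2 : Fin (m + 1) → ℝ)) := by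
      refine measurable_pi_iff.2 fun i => ?_
      refine Fin.cases ?_ (fun j => ?_) i
      · simp only [Fin.cons_zero]
        exact measurable_fst
      · simp only [Fin.cons_succ]
        exact (measurable_pi_apply j).comp measurable_snd
    have e : ∀ u : (Fin (m + 1) → ℝ) → ℝ≥0∞, Measurable u →
        ∫⁻ x, u x = ∫⁻ x : ℝ, ∫⁻ y : Fin m → ℝ, u (Fin.cons x y) := by
      intro u hu
      have hp := (volume_preserving_piFinSuccAbove (fun _ : Fin (m + 1) => ℝ) 0).symm
      rw [← hp.lintegral_comp hu]
      rw [show (volume : Measure (ℝ × (Fin m → ℝ))) = volume.prod volume from rfl]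
      rw [lintegral_prod]
      · simp [MeasurableEquiv.piFinSuccAbove]
        rfl
      · exact (hu.comp hp.measurable).aemeasurable
    rw [e f hf, e g hg, e h hh]
    apply pl1 t ht0 ht1
    · exact (hf.comp mc2).lintegral_prod_right'
    · exact (hg.comp mc2).lintegral_prod_right'
    · exact (hh.comp mc2).lintegral_prod_right'
    intro x y
    apply ih
    · exact hf.comp (mc x)
    · exact hg.comp (mc y)
    · exact hh.comp (mc _)
    intro z w
    refine (H _ _).trans (le_of_eq ?_)
    congr 1
    ext i
    refine Fin.cases ?_ (fun j => ?_) i <;> simp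

/-- Multiplicative Brunn-Minkowski for compact sets in Euclidean space. -/
lemma bm_mul (m : ℕ) (t : ℝ) (ht0 : 0 < t) (ht1 : t < 1)
    (A B S : Set (EuclideanSpace ℝ (Fin m))) (hA : MeasurableSet A) (hB : MeasurableSet B)
    (hS : MeasurableSet S) (H : ∀ x ∈ A, ∀ y ∈ B, (1 - t) • x + t • y ∈ S) :
    volume A ^ (1 - t) * volume B ^ t ≤ volume S := by
  have ht2 : 0 < 1 - t := by linarith
  have hp := (PiLp.volume_preserving_ofLp (Fin m)).symm (MeasurableEquiv.toLp 2 (Fin m → ℝ)).symm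
  have e : ∀ U : Set (EuclideanSpace ℝ (Fin m)), MeasurableSet U →
      volume U = ∫⁻ x : Fin m → ℝ, U.indicator 1 (WithLp.toLp 2 x) := by
    intro U hU
    have := hp.lintegral_comp (f := U.indicator 1) (measurable_one.indicator hU)
    rw [lintegral_indicator_one hU] at this
    exact this.symm
  rw [e A hA, e B hB, e S hS]
  have mm : ∀ U : Set (EuclideanSpace ℝ (Fin m)), MeasurableSet U →
      Measurable fun x : Fin m → ℝ => (U.indicator 1 (WithLp.toLp 2 x) : ℝ≥0∞) := fun U hU =>
    (measurable_one.indicator hU).comp hp.measurable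
  refine pl m t ht0 ht1 _ _ _ (mm A hA) (mm B hB) (mm S hS) fun x y => ?_
  by_cases hx : WithLp.toLp 2 x ∈ A
  · by_cases hy : WithLp.toLp 2 y ∈ B
    · have : WithLp.toLp 2 ((1 - t) • x + t • y) ∈ S := by simpa using H _ hx _ hy
      rw [indicator_of_mem hx, indicator_of_mem hy, indicator_of_mem this]
      simp
    · simp [hy, ht0]
  · simp [hx, ht2]

lemma vol_affine (m : ℕ) (r : ℝ) (hr : 0 ≤ r) (v : EuclideanSpace ℝ (Fin m))
    (A : Set (EuclideanSpace ℝ (Fin m))) :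
    volume ((fun x => v + r • x) '' A) = ENNReal.ofReal (r ^ m) * volume A := by
  have : (fun x => v + r • x) '' A = (fun x => v + x) '' (r • A) := by
    rw [← image_smul, image_image]
  rw [this, image_add_left, measure_preimage_add, Measure.addHaar_smul_of_nonneg _ hr]
  simp

/-- Brunn-Minkowski in the form needed for compact sets, real valued. -/
lemma bm (m : ℕ) (hm : 1 ≤ m) (t : ℝ) (ht0 : 0 < t) (ht1 : t < 1)
    (A B S : Set (EuclideanSpace ℝ (Fin m))) (hA : IsCompact A) (hB : IsCompact B)
    (hS : IsCompact S) (hA0 : A.Nonempty) (hB0 : B.Nonempty)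
    (H : ∀ x ∈ A, ∀ y ∈ B, (1 - t) • x + t • y ∈ S) :
    (1 - t) * (volume A).toReal ^ ((m:ℝ)⁻¹) + t * (volume B).toReal ^ ((m:ℝ)⁻¹)
      ≤ (volume S).toReal ^ ((m:ℝ)⁻¹) := by
  have hm' : m ≠ 0 := by omega
  have ht2 : 0 < 1 - t := by linarith
  set α := (volume A).toReal ^ ((m:ℝ)⁻¹) with hα
  set β := (volume B).toReal ^ ((m:ℝ)⁻¹) with hβ
  have α0 : 0 ≤ α := by positivity
  have β0 : 0 ≤ β := by positivity
  have αm : α ^ m = (volume A).toReal := Real.rpow_inv_natCast_pow ENNReal.toReal_nonneg hm'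
  have βm : β ^ m = (volume B).toReal := Real.rpow_inv_natCast_pow ENNReal.toReal_nonneg hm'
  have Af : volume A ≠ ⊤ := hA.measure_lt_top.ne
  have Bf : volume B ≠ ⊤ := hB.measure_lt_top.ne
  have Sf : volume S ≠ ⊤ := hS.measure_lt_top.ne
  have αv : ENNReal.ofReal (α ^ m) = volume A := by rw [αm, ENNReal.ofReal_toReal Af]
  have βv : ENNReal.ofReal (β ^ m) = volume B := by rw [βm, ENNReal.ofReal_toReal Bf]
  suffices h : ENNReal.ofReal (((1 - t) * α + t * β) ^ m) ≤ volume S by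
    have h2 : ((1 - t) * α + t * β) ^ m ≤ (volume S).toReal :=
      (ENNReal.ofReal_le_iff_le_toReal Sf).1 h
    have h3 := Real.rpow_le_rpow (z := (m:ℝ)⁻¹) (by positivity) h2 (by positivity)
    rwa [Real.pow_rpow_inv_natCast (by positivity) hm'] at h3
  obtain ⟨a₀, ha₀⟩ := hA0
  obtain ⟨b₀, hb₀⟩ := hB0
  rcases α0.eq_or_lt with ha | ha
  · rw [← ha, mul_zero, zero_add, mul_pow, ENNReal.ofReal_mul (by positivity), βv,
      ← vol_affine m t ht0.le ((1 - t) • a₀)]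
    refine measure_mono ?_
    rintro _ ⟨y, hy, rfl⟩
    exact H _ ha₀ _ hy
  rcases β0.eq_or_lt with hb | hb
  · rw [← hb, mul_zero, add_zero, mul_pow, ENNReal.ofReal_mul (by positivity), αv,
      ← vol_affine m (1 - t) ht2.le (t • b₀)]
    refine measure_mono ?_
    rintro _ ⟨y, hy, rfl⟩
    simp only
    rw [add_comm]
    exact H _ hy _ hb₀
  set D := (1 - t) * α + t * β with hD
  have D0 : 0 < D := by positivity
  have Da : 1 - t * β / D = (1 - t) * α / D := by field_simp; rw [hD]; ring
  have vA : volume ((fun x => (0 : EuclideanSpace ℝ (Fin m)) + α⁻¹ • x) '' A) = 1 := by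
    rw [vol_affine m _ (by positivity), ← αv, ← ENNReal.ofReal_mul (by positivity), ← mul_pow,
      inv_mul_cancel₀ ha.ne']
    simp
  have vB : volume ((fun x => (0 : EuclideanSpace ℝ (Fin m)) + β⁻¹ • x) '' B) = 1 := by
    rw [vol_affine m _ (by positivity), ← βv, ← ENNReal.ofReal_mul (by positivity), ← mul_pow,
      inv_mul_cancel₀ hb.ne']
    simp
  have key := bm_mul m (t * β / D) (by positivity) (by
      rw [div_lt_one D0, hD]; nlinarith) _ _
    ((fun x => (0 : EuclideanSpace ℝ (Fin m)) + D⁻¹ • x) '' S)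
    (hA.image (f := fun x => (0 : EuclideanSpace ℝ (Fin m)) + α⁻¹ • x) (by fun_prop)).measurableSet
    (hB.image (f := fun x => (0 : EuclideanSpace ℝ (Fin m)) + β⁻¹ • x) (by fun_prop)).measurableSet
    (hS.image (by fun_prop)).measurableSet (by
      rintro _ ⟨x, hx, rfl⟩ _ ⟨y, hy, rfl⟩
      refine ⟨_, H x hx y hy, ?_⟩
      simp only
      rw [Da]
      simp only [zero_add, smul_add, smul_smul]
      congr 2 <;> field_simp)
  rw [vA, vB, vol_affine m _ (by positivity)] at key
  simp only [ENNReal.one_rpow, mul_one] at key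
  calc ENNReal.ofReal (D ^ m) = ENNReal.ofReal (D ^ m) * 1 := by rw [mul_one]
    _ ≤ ENNReal.ofReal (D ^ m) * (ENNReal.ofReal (D⁻¹ ^ m) * volume S) := by gcongr
    _ = volume S := by
      rw [← mul_assoc, ← ENNReal.ofReal_mul (by positivity), ← mul_pow, mul_inv_cancel₀ D0.ne']
      simp

end BM

lemma J0 (k : ℕ) (h α β : ℝ) (hh : h ≠ 0) :
    ∫ x in α..β, (1 - x / h) ^ k = h / (k + 1) * ((1 - α / h) ^ (k + 1) - (1 - β / h) ^ (k + 1)) := by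
  have hk : (k : ℝ) + 1 ≠ 0 := by positivity
  have : ∀ x ∈ uIcc α β, HasDerivAt (fun x => - (h / (k + 1) * (1 - x / h) ^ (k + 1)))
      ((1 - x / h) ^ k) x := by
    intro x _
    have h1 : HasDerivAt (fun x => 1 - x / h) (- (1 / h)) x :=
      ((hasDerivAt_id x).div_const h).const_sub 1
    have h2 := ((h1.pow (k + 1)).const_mul (h / (k + 1))).neg
    refine HasDerivAt.congr_deriv h2 ?_
    rw [show k + 1 - 1 = k from rfl]
    push_cast
    generalize (1 - x / h) ^ k = W
    field_simp
  rw [intervalIntegral.integral_eq_sub_of_hasDerivAt this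
    (Continuous.intervalIntegrable (by fun_prop) _ _)]
  ring

lemma J1 (k : ℕ) (h e α β : ℝ) (hh : h ≠ 0) :
    ∫ x in α..β, (x - e) * (1 - x / h) ^ k =
      (h - e) * h / (k + 1) * ((1 - α / h) ^ (k + 1) - (1 - β / h) ^ (k + 1)) -
      h ^ 2 / (k + 2) * ((1 - α / h) ^ (k + 2) - (1 - β / h) ^ (k + 2)) := by
  have hk : (k : ℝ) + 1 ≠ 0 := by positivity
  have hk2 : (k : ℝ) + 2 ≠ 0 := by positivity
  have : ∀ x ∈ uIcc α β, HasDerivAt (fun x => - ((h - e) * h / (k + 1) * (1 - x / h) ^ (k + 1))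
      + h ^ 2 / (k + 2) * (1 - x / h) ^ (k + 2))
      ((x - e) * (1 - x / h) ^ k) x := by
    intro x _
    have h1 : HasDerivAt (fun x => 1 - x / h) (- (1 / h)) x :=
      ((hasDerivAt_id x).div_const h).const_sub 1
    have h2 := (((h1.pow (k + 1)).const_mul ((h - e) * h / (k + 1))).neg).add
      ((h1.pow (k + 2)).const_mul (h ^ 2 / (k + 2)))
    refine HasDerivAt.congr_deriv h2 ?_
    rw [show k + 1 - 1 = k from rfl, show k + 2 - 1 = k + 1 from rfl, pow_succ (1 - x / h) k]
    push_cast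
    generalize (1 - x / h) ^ k = W
    field_simp
    ring
  rw [intervalIntegral.integral_eq_sub_of_hasDerivAt this
    (Continuous.intervalIntegrable (by fun_prop) _ _)]
  ring

lemma exp_bound (k : ℕ) : (1 + 2 / ((k:ℝ) + 1)) ^ k ≤ 8 := by
  have h1 : 1 + 2 / ((k:ℝ) + 1) ≤ Real.exp (2 / ((k:ℝ) + 1)) := by
    have := Real.add_one_le_exp (2 / ((k:ℝ) + 1)); linarith
  calc (1 + 2 / ((k:ℝ) + 1)) ^ k ≤ Real.exp (2 / ((k:ℝ) + 1)) ^ k := by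
        gcongr
    _ = Real.exp (k * (2 / ((k:ℝ) + 1))) := by rw [← Real.exp_nat_mul]
    _ ≤ Real.exp 2 := by
        gcongr
        rw [← mul_div_assoc, div_le_iff₀ (by positivity)]
        linarith
    _ = Real.exp 1 ^ 2 := by rw [← Real.exp_nat_mul]; norm_num
    _ ≤ 2.7182818286 ^ 2 := by gcongr; exact Real.exp_one_lt_d9.le
    _ ≤ 8 := by norm_num

lemma core (k : ℕ) (hk : 1 ≤ k) (a b : ℝ) (ha : a < 0) (hb : 0 < b) (g : ℝ → ℝ)
    (gc : ConcaveOn ℝ (Icc a b) g) (gnn : ∀ x, 0 ≤ g x)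
    (gi : ∀ α β : ℝ, IntervalIntegrable (fun x => g x ^ k) volume α β)
    (gpos : 0 < g 0)
    (V : ℝ) (hV : ∫ x in (0:ℝ)..b, g x ^ k = V) (hV' : ∫ x in a..0, g x ^ k = 1 - V)
    (hM : (∫ x in a..0, x * g x ^ k) + ∫ x in (0:ℝ)..b, x * g x ^ k = 0)
    (b' p : ℝ) (hb' : g 0 ^ k * b' = (k + 1) * V) (hp : 0 < p) (hpV : p ^ (k + 1) = V) :
    b ≤ b' ∧ b' ≤ 8 * (k + 1) * b ∧
      (p * (1 - b / b')) ^ (k + 2) ≤ (k + 2) * p - (k + 1) := by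
  have hN : (0:ℝ) < (k:ℝ) + 1 := by positivity
  have c0 : 0 < g 0 ^ k := by positivity
  have hVpos : 0 < V := by rw [← hpV]; positivity
  have hb'0 : 0 < b' := by
    by_contra hcon
    have h1 : g 0 ^ k * b' ≤ 0 := mul_nonpos_of_nonneg_of_nonpos c0.le (not_lt.1 hcon)
    have : 0 < ((k:ℝ) + 1) * V := by positivity
    linarith
  have xgi : ∀ e α β : ℝ, IntervalIntegrable (fun x => (x - e) * g x ^ k) volume α β :=
    fun e α β => (gi α β).continuousOn_mul (by fun_prop)
  have xgi0 : ∀ α β : ℝ, IntervalIntegrable (fun x => x * g x ^ k) volume α β :=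
    fun α β => (gi α β).continuousOn_mul (by fun_prop)
  have conc : ∀ x y z, a ≤ x → x ≤ z → z ≤ y → y ≤ b →
      (y - z) * g x + (z - x) * g y ≤ (y - x) * g z := by
    intro x y z h1 h2 h3 h4
    rcases eq_or_lt_of_le (h2.trans h3) with h | h
    · have : z = x := by linarith
      subst this; subst h; simp
    · have hyx : 0 < y - x := by linarith
      have := gc.2 (show x ∈ Icc a b from ⟨h1, by linarith⟩) (show y ∈ Icc a b from ⟨by linarith, h4⟩)
        (show 0 ≤ (y - z) / (y - x) from div_nonneg (by linarith) hyx.le)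
        (show 0 ≤ (z - x) / (y - x) from div_nonneg (by linarith) hyx.le)
        (by field_simp; ring)
      simp only [smul_eq_mul] at this
      rw [show (y - z) / (y - x) * x + (z - x) / (y - x) * y = z by field_simp; ring] at this
      have h5 := mul_le_mul_of_nonneg_left this hyx.le
      calc _ = (y - x) * ((y - z) / (y - x) * g x + (z - x) / (y - x) * g y) := by field_simp
        _ ≤ _ := h5
  have S1 : b ≤ b' := by
    have h1 : ∫ x in (0:ℝ)..b, g 0 ^ k * (1 - x / b) ^ k ≤ ∫ x in (0:ℝ)..b, g x ^ k := by
      refine intervalIntegral.integral_mono_on hb.le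
        (Continuous.intervalIntegrable (by fun_prop) _ _) (gi _ _) fun x hx => ?_
      rw [← mul_pow]
      have hx1 : 0 ≤ 1 - x / b := by
        rw [sub_nonneg, div_le_one hb]; exact hx.2
      refine pow_le_pow_left₀ (by positivity) ?_ _
      have := conc 0 b x ha.le hx.1 hx.2 le_rfl
      have h2 : 0 ≤ (x - 0) * g b := mul_nonneg (by linarith [hx.1]) (gnn _)
      rw [show g 0 * (1 - x / b) = (b - x) * g 0 / b by field_simp, div_le_iff₀ hb]
      linarith
    rw [intervalIntegral.integral_const_mul, J0 _ _ _ _ hb.ne', hV] at h1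
    simp only [zero_div, sub_zero, one_pow, div_self hb.ne', sub_self] at h1
    rw [zero_pow (by omega), sub_zero, mul_one] at h1
    have h2 : g 0 ^ k * b ≤ g 0 ^ k * b' := by
      rw [hb']
      calc g 0 ^ k * b = (k + 1) * (g 0 ^ k * (b / (k + 1))) := by field_simp
        _ ≤ _ := by gcongr
    exact le_of_mul_le_mul_left h2 c0
  have S2 : ∀ m ∈ Icc 0 b, g m ≤ g 0 * (1 + 2 / (k + 1)) := by
    intro m hm
    by_contra! hcon
    have hm0 : 0 < m := by
      rcases eq_or_lt_of_le hm.1 with h | h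
      · rw [← h] at hcon
        have : 0 < g 0 * (2 / ((k:ℝ) + 1)) := by positivity
        linarith
      · exact h
    set y := g m / g 0 - 1 with hy
    have hgm : g m = g 0 * (1 + y) := by rw [hy]; field_simp; ring
    have hy2 : 2 / ((k:ℝ) + 1) < y := by
      rw [hgm] at hcon
      have := lt_of_mul_lt_mul_left hcon gpos.le
      linarith
    have hy0 : 0 < y := lt_trans (by positivity) hy2
    set h := - (m / y) with hh
    have hmy : 0 < m / y := by positivity
    have hh0 : h < 0 := by linarith
    have line : ∀ x ∈ Icc a 0, g x ≤ g 0 * (1 - x / h) := by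
      intro x hx
      have h1 := conc x m 0 hx.1 hx.2 hm0.le hm.2
      rw [hgm] at h1
      have h2 : g 0 * (1 - x / h) = g 0 * (m + x * y) / m := by
        rw [hh]; field_simp; ring
      rw [h2, le_div_iff₀ hm0]
      linarith
    have hah : h ≤ a := by
      have h1 := (gnn a).trans (line a ⟨le_rfl, ha.le⟩)
      have h2 := nonneg_of_mul_nonneg_right h1 gpos
      rw [sub_nonneg, div_le_one_of_neg hh0] at h2
      exact h2
    have left : -(g 0 ^ k * (h ^ 2 / ((k + 1) * (k + 2)))) ≤ ∫ x in a..0, x * g x ^ k := by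
      have e1 : ∫ x in h..0, (x - 0) * (1 - x / h) ^ k = -(h ^ 2 / ((k + 1) * (k + 2))) := by
        rw [J1 _ _ _ _ _ hh0.ne]
        simp only [div_self hh0.ne, sub_self, sub_zero, zero_div, one_pow]
        rw [zero_pow (by omega), zero_pow (by omega)]
        field_simp
        ring
      have e2 : ∫ x in h..0, (x - 0) * (1 - x / h) ^ k ≤ ∫ x in a..0, (x - 0) * (1 - x / h) ^ k := by
        rw [← intervalIntegral.integral_add_adjacent_intervals (b := a)
          (Continuous.intervalIntegrable (by fun_prop) _ _)
          (Continuous.intervalIntegrable (by fun_prop) _ _)]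
        have : ∫ x in h..a, (x - 0) * (1 - x / h) ^ k ≤ ∫ x in h..a, (0:ℝ) := by
          refine intervalIntegral.integral_mono_on hah
            (Continuous.intervalIntegrable (by fun_prop) _ _)
            (Continuous.intervalIntegrable (by fun_prop) _ _) fun x hx => ?_
          have h3 : 0 ≤ 1 - x / h := by
            rw [sub_nonneg, div_le_one_of_neg hh0]; exact hx.1
          exact mul_nonpos_of_nonpos_of_nonneg (by linarith [hx.2]) (by positivity)
        simp only [intervalIntegral.integral_zero] at this
        linarith
      have e3 : g 0 ^ k * ∫ x in a..0, (x - 0) * (1 - x / h) ^ k ≤ ∫ x in a..0, x * g x ^ k := by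
        rw [← intervalIntegral.integral_const_mul]
        refine intervalIntegral.integral_mono_on ha.le
            (Continuous.intervalIntegrable (by fun_prop) _ _) (xgi0 _ _) fun x hx => ?_
        have h4 := pow_le_pow_left₀ (gnn x) (line x hx) k
        rw [mul_pow] at h4
        have := mul_le_mul_of_nonpos_left h4 hx.2
        linarith
      rw [e1] at e2
      have := mul_le_mul_of_nonneg_left e2 c0.le
      linarith
    have right : g 0 ^ k * (m ^ 2 / 2) ≤ ∫ x in (0:ℝ)..b, x * g x ^ k := by
      rw [← intervalIntegral.integral_add_adjacent_intervals (xgi0 0 m) (xgi0 m b)]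
      have e1 : 0 ≤ ∫ x in m..b, x * g x ^ k :=
        intervalIntegral.integral_nonneg hm.2 fun x hx =>
          mul_nonneg (by linarith [hx.1]) (pow_nonneg (gnn x) _)
      have e2 : ∫ x in (0:ℝ)..m, g 0 ^ k * x ≤ ∫ x in (0:ℝ)..m, x * g x ^ k := by
        refine intervalIntegral.integral_mono_on hm0.le
            (Continuous.intervalIntegrable (by fun_prop) _ _) (xgi0 _ _) fun x hx => ?_
        rw [mul_comm]
        refine mul_le_mul_of_nonneg_left (pow_le_pow_left₀ gpos.le ?_ _) hx.1
        have h1 := conc 0 m x ha.le hx.1 hx.2 hm.2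
        have h2 : g 0 ≤ g m := by rw [hgm]; nlinarith
        have h3 : x * g 0 ≤ x * g m := mul_le_mul_of_nonneg_left h2 hx.1
        have : m * g 0 ≤ m * g x := by linarith
        exact le_of_mul_le_mul_left this hm0
      rw [intervalIntegral.integral_const_mul, integral_id] at e2
      have : (m ^ 2 - 0 ^ 2) / 2 = m ^ 2 / 2 := by ring
      rw [this] at e2
      linarith
    have h1 : g 0 ^ k * (m ^ 2 / 2) ≤ g 0 ^ k * (h ^ 2 / ((k + 1) * (k + 2))) := by linarith
    have h2 := le_of_mul_le_mul_left h1 c0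
    rw [hh, neg_sq, div_pow, div_div, div_le_div_iff₀ (by positivity) (by positivity)] at h2
    have h3 : y ^ 2 * ((k + 1) * (k + 2)) ≤ 2 := le_of_mul_le_mul_left h2 (by positivity)
    have h4 : 2 < y * (k + 1) := by rwa [div_lt_iff₀ hN] at hy2
    nlinarith [mul_pos hy0 hN]
  have S3 : b' ≤ 8 * (k + 1) * b := by
    have h1 : ∫ x in (0:ℝ)..b, g x ^ k ≤ ∫ x in (0:ℝ)..b, g 0 ^ k * 8 := by
      refine intervalIntegral.integral_mono_on hb.le (gi _ _)
        (Continuous.intervalIntegrable (by fun_prop) _ _) fun x hx => ?_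
      calc g x ^ k ≤ (g 0 * (1 + 2 / (k + 1))) ^ k := pow_le_pow_left₀ (gnn x) (S2 x hx) _
        _ = g 0 ^ k * (1 + 2 / (k + 1)) ^ k := mul_pow _ _ _
        _ ≤ _ := by gcongr; exact exp_bound k
    rw [hV] at h1
    simp only [intervalIntegral.integral_const, sub_zero, smul_eq_mul] at h1
    have : g 0 ^ k * b' ≤ g 0 ^ k * (8 * (k + 1) * b) := by
      rw [hb']
      nlinarith
    exact le_of_mul_le_mul_left this c0
  refine ⟨S1, S3, ?_⟩
  set P : ℝ → ℝ := fun x => g 0 * (1 - x / b') with hP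
  have Pk : ∀ x, P x ^ k = g 0 ^ k * (1 - x / b') ^ k := fun x => mul_pow _ _ _
  have Pc : Continuous P := by fun_prop
  have Pi : ∀ α β, IntervalIntegrable (fun x => P x ^ k) volume α β := fun α β =>
    Continuous.intervalIntegrable (by fun_prop) _ _
  have xPi : ∀ e α β, IntervalIntegrable (fun x => (x - e) * P x ^ k) volume α β := fun e α β =>
    Continuous.intervalIntegrable (by fun_prop) _ _
  have Pnn : ∀ x ≤ b', 0 ≤ P x := by
    intro x hx
    have : x / b' ≤ 1 := by rwa [div_le_one hb'0]
    exact mul_nonneg gpos.le (by linarith)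
  have IP : ∀ α β, ∫ x in α..β, P x ^ k =
      V * ((1 - α / b') ^ (k + 1) - (1 - β / b') ^ (k + 1)) := by
    intro α β
    simp only [Pk]
    rw [intervalIntegral.integral_const_mul, J0 _ _ _ _ hb'0.ne', ← mul_assoc, ← mul_div_assoc, hb']
    field_simp
  have IP1 : ∫ x in (0:ℝ)..b', P x ^ k = V := by
    rw [IP]; simp [hb'0.ne']
  have moment : ∀ e α β (F : ℝ → ℝ), IntervalIntegrable F volume α β → ∫ x in α..β, (x - e) * F x
      = (∫ x in α..β, x * F x) - e * ∫ x in α..β, F x := by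
    intro e α β F hF
    rw [← intervalIntegral.integral_const_mul, ← intervalIntegral.integral_sub]
    · congr 1; ext x; ring
    · exact hF.continuousOn_mul (by fun_prop)
    · exact hF.const_mul _
  obtain ⟨x0, ⟨hx00, hx0b⟩, hx0⟩ : ∃ x0 ∈ Ioc 0 b, P x0 ≤ g x0 := by
    by_contra! hcon
    have h1 : 0 < ∫ x in (0:ℝ)..b, (P x ^ k - g x ^ k) := by
      refine intervalIntegral.intervalIntegral_pos_of_pos_on ((Pi _ _).sub (gi _ _))
        (fun x hx => ?_) hb
      have := hcon x ⟨hx.1, hx.2.le⟩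
      have := pow_lt_pow_left₀ this (gnn x) (by omega : k ≠ 0)
      linarith
    rw [intervalIntegral.integral_sub (Pi _ _) (gi _ _), hV] at h1
    rw [← intervalIntegral.integral_add_adjacent_intervals (Pi 0 b) (Pi b b')] at IP1
    have h2 : 0 ≤ ∫ x in b..b', P x ^ k :=
      intervalIntegral.integral_nonneg S1 fun x hx => pow_nonneg (Pnn x hx.2) _
    linarith
  have left_le : ∀ x ∈ Icc a 0, g x ≤ P x := by
    intro x hx
    have h1 := conc x x0 0 hx.1 hx.2 hx00.le hx0b
    have h2 : (0 - x) * P x0 ≤ (0 - x) * g x0 :=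
      mul_le_mul_of_nonneg_left hx0 (by linarith [hx.2])
    have h3 : x0 * g x ≤ x0 * P x := by
      have : x0 * P x = (x0 - x) * g 0 - (0 - x) * P x0 := by simp only [hP]; field_simp; ring
      linarith
    exact le_of_mul_le_mul_left h3 hx00
  set a' := b' - b' / p with ha'
  have qa' : 1 - a' / b' = 1 / p := by rw [ha']; field_simp; ring
  have hV1 : V < 1 ∨ V = 1 := by
    have : 0 ≤ 1 - V := by
      rw [← hV']
      exact intervalIntegral.integral_nonneg ha.le fun x _ => pow_nonneg (gnn x) _
    exact lt_or_eq_of_le (by linarith)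
  have hp1 : p ≤ 1 := by
    by_contra! hcon
    have := one_lt_pow₀ hcon (by omega : k + 1 ≠ 0)
    rcases hV1 with h | h <;> linarith
  have ha'0 : a' ≤ 0 := by
    have : b' ≤ b' / p := by rw [le_div_iff₀ hp]; nlinarith
    linarith
  have IP2 : ∫ x in a'..0, P x ^ k = 1 - V := by
    simp only [IP, qa', zero_div, sub_zero, one_pow]
    rw [← hpV, mul_sub, ← mul_pow, mul_one_div_cancel hp.ne', one_pow, mul_one]
  have haa' : a ≤ a' := by
    have h1 : ∫ x in a..0, g x ^ k ≤ ∫ x in a..0, P x ^ k :=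
      intervalIntegral.integral_mono_on ha.le (gi _ _) (Pi _ _) fun x hx =>
        pow_le_pow_left₀ (gnn x) (left_le x hx) _
    rw [hV', ← IP2, IP, IP] at h1
    have h2 := le_of_mul_le_mul_left h1 hVpos
    have h3 : (1 - a' / b') ^ (k + 1) ≤ (1 - a / b') ^ (k + 1) := by linarith
    have h5 : 0 ≤ 1 - a / b' := by
      have : a / b' ≤ 0 := div_nonpos_of_nonpos_of_nonneg ha.le hb'0.le
      linarith
    have h4 := le_of_pow_le_pow_left₀ (by omega) h5 h3
    have h6 : a / b' ≤ a' / b' := by linarith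
    exact (div_le_div_iff_of_pos_right hb'0).1 h6
  have Left : ∫ x in a..0, x * g x ^ k ≤ ∫ x in a'..0, x * P x ^ k := by
    have h1 : ∫ x in a..a', (x - a') * g x ^ k ≤ ∫ x in a..a', (0:ℝ) := by
      refine intervalIntegral.integral_mono_on haa' (xgi _ _ _) (by simp) fun x hx => ?_
      exact mul_nonpos_of_nonpos_of_nonneg (by linarith [hx.2]) (pow_nonneg (gnn x) _)
    simp only [intervalIntegral.integral_zero] at h1
    have h2 : ∫ x in a'..0, (x - a') * g x ^ k ≤ ∫ x in a'..0, (x - a') * P x ^ k := by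
      refine intervalIntegral.integral_mono_on ha'0 (xgi _ _ _) (xPi _ _ _) fun x hx => ?_
      exact mul_le_mul_of_nonneg_left (pow_le_pow_left₀ (gnn x)
        (left_le x ⟨haa'.trans hx.1, hx.2⟩) _) (by linarith [hx.1])
    have h3 := intervalIntegral.integral_add_adjacent_intervals (xgi a' a a') (xgi a' a' 0)
    rw [moment a' a 0 _ (gi _ _), hV'] at h3
    rw [moment a' a' 0 _ (Pi _ _), IP2] at h2
    linarith
  set X := {x | x ∈ Icc 0 b ∧ P x ≤ g x} with hX
  have Xne : X.Nonempty := ⟨0, ⟨le_rfl, hb.le⟩, by simp [hP]⟩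
  have Xbdd : BddAbove X := ⟨b, fun x hx => hx.1.2⟩
  set x1 := sSup X with hx1
  have x1b : x1 ≤ b := csSup_le Xne fun x hx => hx.1.2
  have cr1 : ∀ x, 0 ≤ x → x < x1 → P x ≤ g x := by
    intro x hx0' hx
    obtain ⟨z, hz, hxz⟩ := exists_lt_of_lt_csSup Xne hx
    have h1 := conc 0 z x ha.le hx0' hxz.le hz.1.2
    have h2 : (x - 0) * P z ≤ (x - 0) * g z := mul_le_mul_of_nonneg_left hz.2 (by linarith)
    have h3 : z * P x ≤ z * g x := by
      have : z * P x = (z - x) * g 0 + (x - 0) * P z := by simp only [hP]; field_simp; ring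
      linarith
    exact le_of_mul_le_mul_left h3 (by linarith)
  have cr2 : ∀ x, 0 ≤ x → x ≤ b → x1 < x → g x ≤ P x := by
    intro x h0 h1 h2
    by_contra! hcon
    exact absurd (le_csSup Xbdd (show x ∈ X from ⟨⟨h0, h1⟩, hcon.le⟩)) (not_le.2 h2)
  have Right : (∫ x in (0:ℝ)..b, x * g x ^ k) + ∫ x in b..b', (x - b) * P x ^ k
      ≤ ∫ x in (0:ℝ)..b', x * P x ^ k := by
    have h1 : ∫ x in (0:ℝ)..b, (x - x1) * g x ^ k ≤ ∫ x in (0:ℝ)..b, (x - x1) * P x ^ k := by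
      refine intervalIntegral.integral_mono_on hb.le (xgi _ _ _) (xPi _ _ _) fun x hx => ?_
      rcases lt_trichotomy x x1 with h | h | h
      · exact mul_le_mul_of_nonpos_left (pow_le_pow_left₀ (Pnn x (hx.2.trans S1))
          (cr1 x hx.1 h) _) (by linarith)
      · simp [h]
      · exact mul_le_mul_of_nonneg_left (pow_le_pow_left₀ (gnn x) (cr2 x hx.1 hx.2 h) _)
          (by linarith)
    have h2 : ∫ x in b..b', (x - b) * P x ^ k ≤ ∫ x in b..b', (x - x1) * P x ^ k := by
      refine intervalIntegral.integral_mono_on S1 (xPi _ _ _) (xPi _ _ _) fun x hx => ?_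
      exact mul_le_mul_of_nonneg_right (by linarith) (pow_nonneg (Pnn x hx.2) _)
    have h3 := intervalIntegral.integral_add_adjacent_intervals (xPi x1 0 b) (xPi x1 b b')
    rw [moment x1 0 b' _ (Pi _ _), IP1] at h3
    rw [moment x1 0 b _ (gi _ _), hV] at h1
    linarith
  have E1 : ∫ x in b..b', (x - b) * P x ^ k
      = g 0 ^ k * (b' ^ 2 / ((k + 1) * (k + 2)) * (1 - b / b') ^ (k + 2)) := by
    have : ∀ x, (x - b) * P x ^ k = g 0 ^ k * ((x - b) * (1 - x / b') ^ k) := by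
      intro x; rw [Pk]; ring
    simp only [this]
    rw [intervalIntegral.integral_const_mul, J1 _ _ _ _ _ hb'0.ne']
    simp only [div_self hb'0.ne', sub_self]
    rw [zero_pow (by omega), zero_pow (by omega)]
    have hw : b' - b = b' * (1 - b / b') := by field_simp
    rw [hw]
    generalize 1 - b / b' = w
    field_simp
    ring
  have E2 : (∫ x in a'..0, x * P x ^ k) + ∫ x in (0:ℝ)..b', x * P x ^ k
      = g 0 ^ k * (b' ^ 2 / (k + 1) * (1 / p) ^ (k + 1) - b' ^ 2 / (k + 2) * (1 / p) ^ (k + 2)) := by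
    rw [intervalIntegral.integral_add_adjacent_intervals
      (Continuous.intervalIntegrable (by fun_prop) _ _)
      (Continuous.intervalIntegrable (by fun_prop) _ _)]
    have : ∀ x, x * P x ^ k = g 0 ^ k * ((x - 0) * (1 - x / b') ^ k) := by
      intro x; rw [Pk]; ring
    simp only [this]
    rw [intervalIntegral.integral_const_mul, J1 _ _ _ _ _ hb'0.ne', qa']
    simp only [div_self hb'0.ne', sub_self]
    rw [zero_pow (by omega), zero_pow (by omega)]
    ring
  have F : g 0 ^ k * (b' ^ 2 / ((k + 1) * (k + 2)) * (1 - b / b') ^ (k + 2)) ≤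
      g 0 ^ k * (b' ^ 2 / (k + 1) * (1 / p) ^ (k + 1) - b' ^ 2 / (k + 2) * (1 / p) ^ (k + 2)) := by
    rw [← E1, ← E2]; linarith
  have F2 := le_of_mul_le_mul_left F c0
  have F3 := mul_le_mul_of_nonneg_left F2
    (show 0 ≤ p ^ (k + 2) * ((k + 1) * (k + 2)) / b' ^ 2 by positivity)
  rw [mul_pow]
  calc p ^ (k + 2) * (1 - b / b') ^ (k + 2) = p ^ (k + 2) * ((k + 1) * (k + 2)) / b' ^ 2 *
        (b' ^ 2 / ((k + 1) * (k + 2)) * (1 - b / b') ^ (k + 2)) := by field_simp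
    _ ≤ _ := F3
    _ = (p ^ (k + 1) * (1 / p) ^ (k + 1)) * p * (k + 2) -
        (p ^ (k + 2) * (1 / p) ^ (k + 2)) * (k + 1) := by
      generalize 1 / p = q
      field_simp
      ring
    _ = _ := by
      rw [← mul_pow, ← mul_pow, mul_one_div_cancel hp.ne', one_pow, one_pow]; ring


lemma pow_sub_one_le (z : ℝ) (hz : 0 ≤ z) (k : ℕ) : (1 + z) ^ k - 1 ≤ k * z * (1 + z) ^ k := by
  induction k with
  | zero => simp
  | succ k ih =>
    have h1 : (1 + z) * ((1 + z) ^ k - 1) ≤ (1 + z) * (k * z * (1 + z) ^ k) :=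
      mul_le_mul_of_nonneg_left ih (by linarith)
    have h2 : z * 1 ≤ z * (1 + z) ^ (k + 1) :=
      mul_le_mul_of_nonneg_left (one_le_pow₀ (by linarith)) hz
    push_cast
    rw [pow_succ] at *
    nlinarith

lemma three_pow (k : ℕ) : (3:ℝ) ^ k ≤ ((k:ℝ) + 1) ^ (k + 1) := by
  rcases k with _ | _ | k
  · simp
  · norm_num
  · push_cast
    have h0 : (0:ℝ) ≤ k := by positivity
    calc (3:ℝ) ^ (k + 1 + 1) ≤ ((k:ℝ) + 1 + 1 + 1) ^ (k + 1 + 1) := by gcongr; linarith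
      _ ≤ _ := pow_le_pow_right₀ (by linarith) (by omega)

lemma final_est (k : ℕ) (hk : 1 ≤ k) (b b' p d : ℝ) (hb : 0 < b) (hbb : b ≤ b')
    (h8 : b' ≤ 8 * (k + 1) * b) (hp : 0 < p) (hp1 : p ≤ 1)
    (hE : (p * (1 - b / b')) ^ (k + 2) ≤ (k + 2) * p - (k + 1))
    (hd : d = p - ((k:ℝ) + 1) / (k + 2)) :
    2 * p ^ k * (p * (1 - b / b')) + (1 - p * (1 - b / b')) ^ (k + 1) * (b' / b) ^ k - 1
      ≤ 64 * 3 ^ (k + 3) * ((k:ℝ) + 1) ^ (k + 3) * d ^ ((1:ℝ) / (2 * (k + 1))) := by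
  have hb' : 0 < b' := by linarith
  have hbd : 0 < b / b' := by positivity
  have hw0 : 0 ≤ 1 - b / b' := by rw [sub_nonneg, div_le_one hb']; exact hbb
  set ε := p * (1 - b / b') with hε
  have ε0 : 0 ≤ ε := by positivity
  have ε1 : ε ≤ 1 := by rw [hε]; nlinarith
  have hk0 : (1:ℝ) ≤ k := by exact_mod_cast hk
  have hdd : (k + 2) * d = (k + 2) * p - (k + 1) := by rw [hd]; field_simp
  have hd0 : 0 ≤ d := by
    have : 0 ≤ (k + 2) * d := by rw [hdd]; exact (by positivity : 0 ≤ ε ^ (k + 2)).trans hE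
    exact nonneg_of_mul_nonneg_right this (by positivity)
  have hd1 : d ≤ 1 := by
    rw [hd]; have : 0 ≤ ((k:ℝ) + 1) / (k + 2) := by positivity
    linarith
  set q := d ^ ((1:ℝ) / (2 * (k + 1))) with hq
  have q0 : 0 ≤ q := by positivity
  have εq : ε ≤ (k + 2) * q := by
    have h1 : ε ^ (k + 2) ≤ (k + 2) * d := by rw [hdd]; exact hE
    have h2 := Real.rpow_le_rpow (z := ((k + 2 : ℕ) : ℝ)⁻¹) (by positivity) h1 (by positivity)
    rw [Real.pow_rpow_inv_natCast ε0 (by omega), Real.mul_rpow (by positivity) hd0] at h2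
    refine h2.trans ?_
    gcongr
    · calc ((k:ℝ) + 2) ^ (((k + 2 : ℕ) : ℝ)⁻¹) ≤ ((k:ℝ) + 2) ^ (1:ℝ) := by
            apply Real.rpow_le_rpow_of_exponent_le (by linarith)
            exact inv_le_one_of_one_le₀ (by push_cast; linarith)
        _ = _ := Real.rpow_one _
    · rcases hd0.eq_or_lt with h | h
      · rw [hq, ← h, Real.zero_rpow (by positivity), Real.zero_rpow (by positivity)]
      · apply Real.rpow_le_rpow_of_exponent_ge h hd1
        rw [one_div]
        apply inv_anti₀ (by positivity)
        push_cast
        linarith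
  set z := ε * (1 - p) / p * (b' / b) with hz
  have hz0 : 0 ≤ z := by
    have : 0 ≤ 1 - p := by linarith
    positivity
  have hid : (1 - ε) * (b' / b) = 1 + z := by
    rw [hz, hε]; field_simp; ring
  have hpn : (1 - p) * (k + 1) ≤ p := by nlinarith
  have hz8 : z ≤ 8 * ε := by
    have h1 : b' / b ≤ 8 * (k + 1) := by rw [div_le_iff₀ hb]; exact h8
    have h2 : (1 - p) / p * (b' / b) ≤ 8 := by
      calc (1 - p) / p * (b' / b) ≤ (1 - p) / p * (8 * (k + 1)) := by
            apply mul_le_mul_of_nonneg_left h1 (div_nonneg (by linarith) hp.le)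
        _ = 8 * ((1 - p) * (k + 1)) / p := by ring
        _ ≤ 8 := by rw [div_le_iff₀ hp]; linarith
    calc z = ε * ((1 - p) / p * (b' / b)) := by rw [hz]; ring
      _ ≤ ε * 8 := by gcongr
      _ = _ := by ring
  have t1 : (1 - ε) ^ (k + 1) * (b' / b) ^ k ≤ (1 + z) ^ k := by
    rw [← hid, mul_pow, pow_succ]
    have : 0 ≤ 1 - ε := by linarith
    have h3 : (1 - ε) ^ k * (1 - ε) ≤ (1 - ε) ^ k := mul_le_of_le_one_right (by positivity) (by linarith)
    gcongr
  have t2 := pow_sub_one_le z hz0 k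
  have t3 : (k:ℝ) * z * (1 + z) ^ k ≤ k * (8 * ε) * 9 ^ k := by
    gcongr
    linarith
  have t4 : 2 * p ^ k * ε ≤ 2 * ε := by
    have : p ^ k ≤ 1 := pow_le_one₀ hp.le hp1
    nlinarith
  have n9 : (1:ℝ) ≤ 9 ^ k := one_le_pow₀ (by norm_num)
  have e9 : (9:ℝ) ^ k = 3 ^ k * 3 ^ k := by rw [← mul_pow]; norm_num
  have h3k := three_pow k
  calc _ ≤ 2 * ε + k * (8 * ε) * 9 ^ k := by linarith
    _ = ε * (2 + 8 * k * 9 ^ k) := by ring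
    _ ≤ ((k + 2) * q) * (2 * 9 ^ k + 8 * k * 9 ^ k) := by gcongr; linarith
    _ = (k + 2) * (2 + 8 * k) * 3 ^ k * 3 ^ k * q := by rw [e9]; ring
    _ ≤ (64 * 27 * ((k:ℝ) + 1) ^ 2) * 3 ^ k * ((k:ℝ) + 1) ^ (k + 1) * q := by
      have hq2 : ((k:ℝ) + 2) * (2 + 8 * k) ≤ 64 * 27 * ((k:ℝ) + 1) ^ 2 := by nlinarith
      exact mul_le_mul_of_nonneg_right (mul_le_mul (mul_le_mul_of_nonneg_right hq2 (by positivity))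
        h3k (by positivity) (by positivity)) q0
    _ = _ := by ring

lemma conc_of (g : ℝ → ℝ) (a b : ℝ) (gc : ConcaveOn ℝ (Icc a b) g) : ∀ x y z, a ≤ x → x ≤ z → z ≤ y → y ≤ b →
      (y - z) * g x + (z - x) * g y ≤ (y - x) * g z := by
    intro x y z h1 h2 h3 h4
    rcases eq_or_lt_of_le (h2.trans h3) with h | h
    · have : z = x := by linarith
      subst this; subst h; simp
    · have hyx : 0 < y - x := by linarith
      have := gc.2 (show x ∈ Icc a b from ⟨h1, by linarith⟩) (show y ∈ Icc a b from ⟨by linarith, h4⟩)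
        (show 0 ≤ (y - z) / (y - x) from div_nonneg (by linarith) hyx.le)
        (show 0 ≤ (z - x) / (y - x) from div_nonneg (by linarith) hyx.le)
        (by field_simp; ring)
      simp only [smul_eq_mul] at this
      rw [show (y - z) / (y - x) * x + (z - x) / (y - x) * y = z by field_simp; ring] at this
      have h5 := mul_le_mul_of_nonneg_left this hyx.le
      calc _ = (y - x) * ((y - z) / (y - x) * g x + (z - x) / (y - x) * g y) := by field_simp
        _ ≤ _ := h5

/-- the L1 distance of the two profiles -/
lemma int_abs (k : ℕ) (hk : 1 ≤ k) (F0 a' b b' : ℝ) (F : 0 ≤ F0) (ha' : a' ≤ 0) (hb : 0 < b)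
    (hbb : b ≤ b') (c s : ℝ → ℝ)
    (hc : ∀ x, c x = if x ∈ Icc a' b' then F0 * (1 - x / b') ^ k else 0)
    (hs : ∀ x, s x = if x ∈ Icc a' b then F0 * (1 - x / b) ^ k else 0) :
    ∫ x, |c x - s x| = F0 * (b / (k + 1) * ((1 - a' / b) ^ (k + 1) - 1)
      - b' / (k + 1) * ((1 - a' / b') ^ (k + 1) - 1) + b' / (k + 1) - b / (k + 1)) := by
  have hb' : 0 < b' := by linarith
  have sup : Function.support (fun x => |c x - s x|) ⊆ Ioc (a' - 1) b' := by
    intro x hx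
    by_contra hcon
    apply hx
    have h1 : x ∉ Icc a' b' := fun h => hcon ⟨by linarith [h.1], h.2⟩
    have h2 : x ∉ Icc a' b := fun h => h1 ⟨h.1, h.2.trans hbb⟩
    simp only [hc, hs, if_neg h1, if_neg h2]
    simp
  rw [← intervalIntegral.integral_eq_integral_of_support_subset sup]
  have inv : ∀ x, x ≤ b → 0 ≤ 1 - x / b := fun x hx => by
    rw [sub_nonneg, div_le_one hb]; exact hx
  have inv' : ∀ x, x ≤ b' → 0 ≤ 1 - x / b' := fun x hx => by
    rw [sub_nonneg, div_le_one hb']; exact hx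
  have E0 : EqOn (fun x => (0:ℝ)) (fun x => |c x - s x|) (uIoo (a' - 1) a') := by
    rw [uIoo_of_le (by linarith)]
    intro x hx
    have h1 : x ∉ Icc a' b' := fun h => by linarith [h.1, hx.2]
    have h2 : x ∉ Icc a' b := fun h => by linarith [h.1, hx.2]
    simp only [hc, hs, if_neg h1, if_neg h2]
    simp
  have E1 : EqOn (fun x => F0 * (1 - x / b) ^ k - F0 * (1 - x / b') ^ k)
      (fun x => |c x - s x|) (uIoo a' 0) := by
    rw [uIoo_of_le ha']
    intro x hx
    have h1 : x ∈ Icc a' b' := ⟨hx.1.le, by linarith [hx.2]⟩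
    have h2 : x ∈ Icc a' b := ⟨hx.1.le, by linarith [hx.2]⟩
    simp only [hc, hs, if_pos h1, if_pos h2]
    have h3 : x / b ≤ x / b' := by
      have := div_le_div_of_nonneg_left (by linarith [hx.2] : 0 ≤ -x) hb hbb
      rw [neg_div, neg_div] at this
      linarith
    have h4 : F0 * (1 - x / b') ^ k ≤ F0 * (1 - x / b) ^ k := by
      have := inv' x h1.2
      gcongr
    rw [abs_of_nonpos (by linarith)]; ring
  have E2 : EqOn (fun x => F0 * (1 - x / b') ^ k - F0 * (1 - x / b) ^ k)
      (fun x => |c x - s x|) (uIoo 0 b) := by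
    rw [uIoo_of_le hb.le]
    intro x hx
    have h1 : x ∈ Icc a' b' := ⟨by linarith [hx.1], by linarith [hx.2]⟩
    have h2 : x ∈ Icc a' b := ⟨by linarith [hx.1], by linarith [hx.2]⟩
    simp only [hc, hs, if_pos h1, if_pos h2]
    have h3 : x / b' ≤ x / b := div_le_div_of_nonneg_left hx.1.le hb hbb
    have h4 : F0 * (1 - x / b) ^ k ≤ F0 * (1 - x / b') ^ k := by
      have := inv x h2.2
      gcongr
    rw [abs_of_nonneg (by linarith)]
  have E3 : EqOn (fun x => F0 * (1 - x / b') ^ k)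
      (fun x => |c x - s x|) (uIoo b b') := by
    rw [uIoo_of_le hbb]
    intro x hx
    have h1 : x ∈ Icc a' b' := ⟨by linarith [hx.1], by linarith [hx.2]⟩
    have h2 : x ∉ Icc a' b := fun h => by linarith [h.2, hx.1]
    simp only [hc, hs, if_pos h1, if_neg h2]
    have := inv' x h1.2
    rw [sub_zero, abs_of_nonneg (by positivity)]
  have C : ∀ h : ℝ, Continuous (fun x => F0 * (1 - x / h) ^ k) := fun h => by fun_prop
  have I0 := (continuous_const.intervalIntegrable (μ := volume) (a' - 1) a').congr_uIoo E0
  have I1 := (((C b).sub (C b')).intervalIntegrable (μ := volume) a' 0).congr_uIoo E1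
  have I2 := (((C b').sub (C b)).intervalIntegrable (μ := volume) 0 b).congr_uIoo E2
  have I3 := ((C b').intervalIntegrable (μ := volume) b b').congr_uIoo E3
  rw [← intervalIntegral.integral_add_adjacent_intervals ((I0.trans I1).trans I2) I3,
    ← intervalIntegral.integral_add_adjacent_intervals (I0.trans I1) I2,
    ← intervalIntegral.integral_add_adjacent_intervals I0 I1,
    ← intervalIntegral.integral_congr_uIoo E0, ← intervalIntegral.integral_congr_uIoo E1,
    ← intervalIntegral.integral_congr_uIoo E2, ← intervalIntegral.integral_congr_uIoo E3,
    intervalIntegral.integral_sub ((C _).intervalIntegrable _ _) ((C _).intervalIntegrable _ _),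
    intervalIntegral.integral_sub ((C _).intervalIntegrable _ _) ((C _).intervalIntegrable _ _)]
  simp only [intervalIntegral.integral_const_mul, J0 _ _ _ _ hb.ne', J0 _ _ _ _ hb'.ne',
    intervalIntegral.integral_zero, zero_div, sub_zero, one_pow, div_self hb.ne', div_self hb'.ne',
    sub_self]
  rw [zero_pow (by omega)]
  ring


lemma cone_sec (k : ℕ) (A : Set (EuclideanSpace ℝ (Fin k))) (hA : Convex ℝ A) (hA0 : A.Nonempty)
    (a' b : ℝ) (hab : a' < b) (hb : 0 < b) (β : EuclideanSpace ℝ (Fin k)) (x : ℝ) :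
    {y | (x, y) ∈ convexHull ℝ ((({a'} : Set ℝ) ×ˢ
          ((fun y => β + ((b - a') / b) • (y - β)) '' A)) ∪ {(b, β)})} =
      if x ∈ Icc a' b then (fun y => β + ((b - x) / b) • (y - β)) '' A else ∅ := by
  have hD : Convex ℝ ((fun y => β + ((b - a') / b) • (y - β)) '' A) := by
    rintro _ ⟨y, hy, rfl⟩ _ ⟨z, hz, rfl⟩ u v hu hv huv
    refine ⟨u • y + v • z, hA hy hz hu hv huv, ?_⟩
    have hu' : u = 1 - v := by linarith
    subst hu'
    simp only
    module
  have hP : Convex ℝ ((({a'} : Set ℝ) ×ˢ ((fun y => β + ((b - a') / b) • (y - β)) '' A))) :=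
    (convex_singleton a').prod hD
  rw [union_singleton, convexHull_insert (by
    simpa using hA0), hP.convexHull_eq]
  have hba : 0 < b - a' := by linarith
  split_ifs with hx
  · ext y
    simp only [mem_ofPred_eq, mem_convexJoin, mem_singleton_iff, exists_eq_left, mem_image]
    constructor
    · rintro ⟨⟨q1, q2⟩, ⟨h1, ⟨w, hw, h2⟩⟩, u, v, hu, hv, huv, h⟩
      simp only [mem_singleton_iff] at h1 h2
      subst h1
      rw [Prod.ext_iff] at h
      simp only [Prod.fst_add, Prod.smul_fst, smul_eq_mul, Prod.snd_add, Prod.smul_snd] at h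
      refine ⟨w, hw, ?_⟩
      have hu' : u = 1 - v := by linarith
      rw [← h.2, ← h2, ← h.1, hu']
      have e : (b - ((1 - v) * b + v * q1)) / b = v * ((b - q1) / b) := by ring
      rw [e]
      module
    · rintro ⟨w, hw, rfl⟩
      refine ⟨(a', β + ((b - a') / b) • (w - β)), ⟨rfl, w, hw, rfl⟩, (x - a') / (b - a'), (b - x) / (b - a'),
        div_nonneg (by linarith [hx.1]) hba.le, div_nonneg (by linarith [hx.2]) hba.le, by field_simp; ring, ?_⟩
      rw [Prod.ext_iff]
      simp only [Prod.fst_add, Prod.smul_fst, smul_eq_mul, Prod.snd_add, Prod.smul_snd]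
      constructor
      · field_simp; ring
      · have e1 : (x - a') / (b - a') = 1 - (b - x) / (b - a') := by field_simp; ring
        have e2 : (b - x) / b = (b - x) / (b - a') * ((b - a') / b) := by field_simp
        rw [e1, e2]
        module
  · ext y
    simp only [mem_ofPred_eq, mem_convexJoin, mem_singleton_iff, exists_eq_left, mem_empty_iff_false, iff_false]
    rintro ⟨⟨q1, q2⟩, ⟨h1, ⟨w, hw, h2⟩⟩, u, v, hu, hv, huv, h⟩
    simp only [mem_singleton_iff] at h1 h2
    subst h1
    rw [Prod.ext_iff] at h
    simp only [Prod.fst_add, Prod.smul_fst, smul_eq_mul, Prod.snd_add, Prod.smul_snd] at h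
    apply hx
    have hu' : u = 1 - v := by linarith
    rw [← h.1, hu']
    constructor <;> nlinarith

lemma alg (k : ℕ) (F0 a' b b' p V : ℝ) (hb : 0 < b) (hb' : 0 < b') (hp : 0 < p)
    (hF : F0 * b' = (k + 1) * V) (hV : p ^ (k + 1) = V) (ha' : a' = b' - b' / p) :
    F0 * (b / (k + 1) * ((1 - a' / b) ^ (k + 1) - 1)
      - b' / (k + 1) * ((1 - a' / b') ^ (k + 1) - 1) + b' / (k + 1) - b / (k + 1)) =
    2 * p ^ k * (p * (1 - b / b')) + (1 - p * (1 - b / b')) ^ (k + 1) * (b' / b) ^ k - 1 := by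
  have h1 : 1 - a' / b' = 1 / p := by rw [ha']; field_simp; ring
  have h2 : 1 - a' / b = (1 - p * (1 - b / b')) / p * (b' / b) := by rw [ha']; field_simp; ring
  have h3 : F0 = (k + 1) * p ^ (k + 1) / b' := by rw [hV, ← hF]; field_simp
  rw [h1, h2, mul_pow, div_pow, div_pow, div_pow, div_pow, one_pow]
  generalize (1 - p * (1 - b / b')) ^ (k + 1) = Q
  rw [h3]
  have hk : (0:ℝ) < k + 1 := by positivity
  field_simp
  ring


lemma sl_zero (k : ℕ) (K : Set (ℝ × EuclideanSpace ℝ (Fin k))) (a b : ℝ)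
    (ha : IsLeast (Prod.fst '' K) a) (hb : IsGreatest (Prod.fst '' K) b) (x : ℝ) (hx : x ∉ Icc a b) :
    volume {y : EuclideanSpace ℝ (Fin k) | (x, y) ∈ K} = 0 := by
  have : {y : EuclideanSpace ℝ (Fin k) | (x, y) ∈ K} = ∅ := by
    ext y
    simp only [mem_ofPred_eq, mem_empty_iff_false, iff_false]
    intro h
    exact hx ⟨ha.2 ⟨_, h, rfl⟩, hb.2 ⟨_, h, rfl⟩⟩
  rw [this, measure_empty]

lemma sl_meas (k : ℕ) (K : Set (ℝ × EuclideanSpace ℝ (Fin k))) (hK : IsCompact K) :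
    Measurable (fun x : ℝ => volume {y : EuclideanSpace ℝ (Fin k) | (x, y) ∈ K}) :=
  measurable_measure_prodMk_left hK.measurableSet

lemma sl_fub (k : ℕ) (K : Set (ℝ × EuclideanSpace ℝ (Fin k))) (hK : IsCompact K) :
    volume K = ∫⁻ x : ℝ, volume {y : EuclideanSpace ℝ (Fin k) | (x, y) ∈ K} := by
  rw [Measure.volume_eq_prod, Measure.prod_apply hK.measurableSet]
  rfl

lemma sl_fub' (k : ℕ) (K : Set (ℝ × EuclideanSpace ℝ (Fin k))) (hK : IsCompact K) :
    volume (K ∩ {p : ℝ × EuclideanSpace ℝ (Fin k) | 0 ≤ p.1})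
      = ∫⁻ x in Ici (0:ℝ), volume {y : EuclideanSpace ℝ (Fin k) | (x, y) ∈ K} := by
  have hm : MeasurableSet {p : ℝ × EuclideanSpace ℝ (Fin k) | 0 ≤ p.1} :=
    measurableSet_le measurable_const measurable_fst
  rw [Measure.volume_eq_prod, Measure.prod_apply (hK.measurableSet.inter hm), ← lintegral_indicator measurableSet_Ici]
  apply lintegral_congr
  intro x
  by_cases h : 0 ≤ x
  · rw [indicator_of_mem (by exact h)]
    congr 1
    ext y
    simp [h]
  · rw [indicator_of_notMem (by exact h)]
    have : (Prod.mk x ⁻¹' (K ∩ {p : ℝ × EuclideanSpace ℝ (Fin k) | 0 ≤ p.1})) = ∅ := by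
      ext y
      simp [h]
    rw [this, measure_empty]

lemma sl_int (k : ℕ) (K : Set (ℝ × EuclideanSpace ℝ (Fin k))) (hK : IsCompact K) (h4 : volume K = 1) :
    Integrable (fun x : ℝ => (volume {y : EuclideanSpace ℝ (Fin k) | (x, y) ∈ K}).toReal) := by
  apply integrable_toReal_of_lintegral_ne_top (sl_meas k K hK).aemeasurable
  rw [← sl_fub k K hK, h4]
  simp

lemma sl_fin (k : ℕ) (K : Set (ℝ × EuclideanSpace ℝ (Fin k))) (hK : IsCompact K) (x : ℝ) :
    IsCompact {y : EuclideanSpace ℝ (Fin k) | (x, y) ∈ K} := by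
  apply (hK.image continuous_snd).of_isClosed_subset
  · exact hK.isClosed.preimage (by fun_prop : Continuous fun y : EuclideanSpace ℝ (Fin k) => (x, y))
  · intro y hy
    exact ⟨_, hy, rfl⟩

lemma sl_tot (k : ℕ) (K : Set (ℝ × EuclideanSpace ℝ (Fin k))) (hK : IsCompact K) (h4 : volume K = 1) :
    ∫ x : ℝ, (volume {y : EuclideanSpace ℝ (Fin k) | (x, y) ∈ K}).toReal = 1 := by
  rw [integral_toReal (sl_meas k K hK).aemeasurable
    (Filter.Eventually.of_forall fun x => (sl_fin k K hK x).measure_lt_top), ← sl_fub k K hK, h4]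
  simp

lemma sl_half (k : ℕ) (K : Set (ℝ × EuclideanSpace ℝ (Fin k))) (hK : IsCompact K) :
    ∫ x in Ici (0:ℝ), (volume {y : EuclideanSpace ℝ (Fin k) | (x, y) ∈ K}).toReal =
      (volume (K ∩ {p : ℝ × EuclideanSpace ℝ (Fin k) | 0 ≤ p.1})).toReal := by
  rw [integral_toReal (sl_meas k K hK).aemeasurable
    (Filter.Eventually.of_forall fun x => (sl_fin k K hK x).measure_lt_top), ← sl_fub' k K hK]

lemma sl_mom (k : ℕ) (K : Set (ℝ × EuclideanSpace ℝ (Fin k))) (hK : IsCompact K)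
    (h1 : (∫ p in K, p) = 0) :
    ∫ x : ℝ, x * (volume {y : EuclideanSpace ℝ (Fin k) | (x, y) ∈ K}).toReal = 0 := by
  have i1 : IntegrableOn (fun p : ℝ × EuclideanSpace ℝ (Fin k) => p) K :=
    continuous_id.continuousOn.integrableOn_compact hK
  have h2 := (ContinuousLinearMap.fst ℝ ℝ (EuclideanSpace ℝ (Fin k))).integral_comp_comm i1
  rw [h1, map_zero] at h2
  simp only [ContinuousLinearMap.coe_fst'] at h2
  have i2 : IntegrableOn (fun p : ℝ × EuclideanSpace ℝ (Fin k) => p.1) K :=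
    continuous_fst.continuousOn.integrableOn_compact hK
  rw [← integral_indicator hK.measurableSet, Measure.volume_eq_prod, integral_prod _ (by
    rw [← Measure.volume_eq_prod]; exact i2.integrable_indicator hK.measurableSet)] at h2
  rw [← h2]
  apply integral_congr_ae
  refine Filter.Eventually.of_forall fun x => ?_
  simp only
  have : (fun y : EuclideanSpace ℝ (Fin k) => K.indicator (fun p => p.1) (x, y))
      = {y : EuclideanSpace ℝ (Fin k) | (x, y) ∈ K}.indicator (fun _ => x) := by
    ext y
    by_cases h : (x, y) ∈ K <;> simp [h, indicator]
  rw [this, integral_indicator (sl_fin k K hK x).measurableSet, setIntegral_const, smul_eq_mul, mul_comm]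
  rfl

/-- one-dimensional bookkeeping -/
lemma one_dim (F : ℝ → ℝ) (a b : ℝ) (hab : a ≤ b) (F0 : ∀ x, 0 ≤ F x) (Fz : ∀ x, x ∉ Icc a b → F x = 0)
    (Fi : Integrable F) (F1 : ∫ x, F x = 1) (FM : ∫ x, x * F x = 0) :
    a < 0 ∧ 0 < b ∧ (∫ x in a..0, F x) = 1 - (∫ x in (0:ℝ)..b, F x) ∧
      (∫ x in Ici (0:ℝ), F x) = (∫ x in (0:ℝ)..b, F x) ∧
      (∫ x in a..0, x * F x) + (∫ x in (0:ℝ)..b, x * F x) = 0 := by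
  have iM : Integrable (fun x => x * F x) := by
    have h1 : IntegrableOn (fun x => x * F x) (Icc a b) :=
      Fi.integrableOn.continuousOn_mul continuousOn_id isCompact_Icc
    rwa [integrableOn_iff_integrable_of_support_subset] at h1
    intro x hx
    by_contra h
    exact hx (by simp [Fz x h])
  have key : ∀ G : ℝ → ℝ, (∀ x, G x = 0 → F x = 0 ∨ x = 0) → ¬ (0 ≤ G ∧ Integrable G ∧ ∫ x, G x = 0) := by
    rintro G hG ⟨h0, h1, h2⟩
    rw [integral_eq_zero_iff_of_nonneg h0 h1] at h2
    have : F =ᵐ[volume] 0 := by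
      have h3 : ∀ᵐ x : ℝ, x ≠ 0 := by
        rw [ae_iff]; simp
      filter_upwards [h2, h3] with x hx hx3
      exact (hG x hx).resolve_right hx3
    rw [integral_congr_ae this] at F1
    simp at F1
  have a0 : a < 0 := by
    by_contra! h
    refine key (fun x => x * F x) (fun x hx => (mul_eq_zero.1 hx).symm) ⟨fun x => ?_, iM, FM⟩
    by_cases hx : x ∈ Icc a b
    · exact mul_nonneg (h.trans hx.1) (F0 x)
    · simp [Fz x hx]
  have b0 : 0 < b := by
    by_contra! h
    refine key (fun x => -(x * F x)) (fun x hx => (mul_eq_zero.1 (neg_eq_zero.1 hx)).symm)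
      ⟨fun x => ?_, iM.neg, by rw [integral_neg, FM, neg_zero]⟩
    by_cases hx : x ∈ Icc a b
    · have : 0 ≤ (-x) * F x := mul_nonneg (by linarith [hx.2]) (F0 x)
      simp only [Pi.zero_apply]; linarith
    · simp [Fz x hx]
  have full : ∀ G : ℝ → ℝ, Integrable G → (∀ x, x ∉ Icc a b → G x = 0) →
      (∫ x in a..0, G x) + (∫ x in (0:ℝ)..b, G x) = ∫ x, G x := by
    intro G Gi Gz
    rw [intervalIntegral.integral_add_adjacent_intervals Gi.intervalIntegrable Gi.intervalIntegrable,
      intervalIntegral.integral_of_le hab, ← integral_Icc_eq_integral_Ioc]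
    exact setIntegral_eq_integral_of_forall_compl_eq_zero Gz
  refine ⟨a0, b0, ?_, ?_, ?_⟩
  · have := full F Fi Fz; linarith
  · rw [intervalIntegral.integral_of_le b0.le, ← integral_Icc_eq_integral_Ioc]
    apply setIntegral_eq_of_subset_of_forall_diff_eq_zero measurableSet_Ici (fun x hx => hx.1)
    intro x hx
    apply Fz
    intro h
    exact hx.2 ⟨hx.1, h.2⟩
  · rw [full _ iM (fun x hx => by simp [Fz x hx]), FM]

theorem main' (k : ℕ) (hk : 1 ≤ k)
    (K : Set (ℝ × EuclideanSpace ℝ (Fin k)))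
    (hKcomp : IsCompact K) (hKconv : Convex ℝ K)
    (hH1 : (∫ p in K, p) = 0)
    (hH4 : volume K = 1)
    (a b : ℝ)
    (ha : IsLeast (Prod.fst '' K) a) (hb : IsGreatest (Prod.fst '' K) b)
    (a' b' : ℝ)
    (hb' : b' = (((k + 1 : ℕ):ℝ) / (volume {y : EuclideanSpace ℝ (Fin k) | ((0:ℝ), y) ∈ K}).toReal)
            * (volume (K ∩ {p : ℝ × EuclideanSpace ℝ (Fin k) | 0 ≤ p.1})).toReal)
    (ha' : a' = b' - ((((k + 1 : ℕ):ℝ) * b' ^ k)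
            / (volume {y : EuclideanSpace ℝ (Fin k) | ((0:ℝ), y) ∈ K}).toReal)
              ^ (((k + 1 : ℕ):ℝ)⁻¹))
    (β : EuclideanSpace ℝ (Fin k))
    (C : Set (ℝ × EuclideanSpace ℝ (Fin k)))
    (hC : C = convexHull ℝ
      ((({a'} : Set ℝ) ×ˢ
          ((fun y => β + ((b - a') / b) • (y - β)) ''
            {y : EuclideanSpace ℝ (Fin k) | ((0:ℝ), y) ∈ K}))
        ∪ {(b, β)}))
    (g : ℝ → ℝ)
    (hg : ∀ x, g x = (volume {y : EuclideanSpace ℝ (Fin k) | (x, y) ∈ K}).toReal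
              ^ ((((k + 1 : ℕ):ℝ) - 1)⁻¹))
    (s : ℝ → ℝ)
    (hs : ∀ x, s x = (volume {y : EuclideanSpace ℝ (Fin k) | (x, y) ∈ C}).toReal
              ^ ((((k + 1 : ℕ):ℝ) - 1)⁻¹))
    (c : ℝ → ℝ)
    (hc : ∀ x, c x = if x ∈ Icc a' b' then g 0 * (b' - x) / b' else 0)
    (d : ℝ)
    (hd : d = (volume (K ∩ {p : ℝ × EuclideanSpace ℝ (Fin k) | 0 ≤ p.1})).toReal ^ (((k + 1 : ℕ):ℝ)⁻¹)
            - ((((k + 1 : ℕ):ℝ) / (((k + 1 : ℕ):ℝ) + 1)) ^ (k + 1)) ^ (((k + 1 : ℕ):ℝ)⁻¹)) :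
    (∫ x, |c x ^ k - s x ^ k|) ≤
      64 * (3:ℝ) ^ (k + 3) * ((k + 1 : ℕ):ℝ) ^ (k + 3) * d ^ ((1:ℝ) / (2 * ((k + 1 : ℕ):ℝ))) := by
  have hk0 : k ≠ 0 := by omega
  have hkc : (((k + 1 : ℕ):ℝ) - 1) = (k:ℝ) := by push_cast; ring
  rw [hkc] at hg hs
  set F : ℝ → ℝ := fun x => (volume {y : EuclideanSpace ℝ (Fin k) | (x, y) ∈ K}).toReal with hF
  have Fn : ∀ x, 0 ≤ F x := fun x => ENNReal.toReal_nonneg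
  have gF : ∀ x, g x ^ k = F x := fun x => by rw [hg]; exact Real.rpow_inv_natCast_pow (Fn x) hk0
  have gnn : ∀ x, 0 ≤ g x := fun x => by rw [hg]; exact Real.rpow_nonneg (Fn x) _
  have Fz : ∀ x, x ∉ Icc a b → F x = 0 := fun x hx => by
    simp only [hF]; rw [sl_zero k K a b ha hb x hx]; simp
  have Fi : Integrable F := sl_int k K hKcomp hH4
  have F1 : ∫ x, F x = 1 := sl_tot k K hKcomp hH4
  have FM : ∫ x, x * F x = 0 := sl_mom k K hKcomp hH1
  obtain ⟨a0, b0, hV', hV, hM⟩ := one_dim F a b (ha.2 hb.1) Fn Fz Fi F1 FM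
  have hVv : (volume (K ∩ {p : ℝ × EuclideanSpace ℝ (Fin k) | 0 ≤ p.1})).toReal
      = ∫ x in (0:ℝ)..b, F x := by rw [← hV]; exact (sl_half k K hKcomp).symm
  rw [hVv] at hb' hd
  have ne : ∀ x ∈ Icc a b, ({y : EuclideanSpace ℝ (Fin k) | (x, y) ∈ K}).Nonempty := by
    intro x hx
    have hcv : Convex ℝ (Prod.fst '' K) := hKconv.is_linear_image (LinearMap.fst ℝ ℝ _).isLinear
    obtain ⟨⟨x', y⟩, h1, h2⟩ := hcv.ordConnected.out ha.1 hb.1 hx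
    simp only at h2
    subst h2
    exact ⟨y, h1⟩
  have gc : ConcaveOn ℝ (Icc a b) g := by
    refine ⟨convex_Icc a b, ?_⟩
    intro x hx y hy u v hu hv huv
    have hu' : u = 1 - v := by linarith
    rcases hv.eq_or_lt with hv0 | hv0
    · have hu1 : u = 1 := by linarith
      simp [hu1, ← hv0]
    rcases hu.eq_or_lt with hu0 | hu0
    · have hv1 : v = 1 := by linarith
      simp [hv1, ← hu0]
    have := bm k hk v hv0 (by linarith) _ _ _ (sl_fin k K hKcomp x) (sl_fin k K hKcomp y)
      (sl_fin k K hKcomp (u • x + v • y)) (ne x hx) (ne y hy) (by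
        intro p hp q hq
        rw [hu']
        exact hKconv (show (x, p) ∈ K from hp) (show (y, q) ∈ K from hq) (by linarith : 0 ≤ 1 - v) hv (by ring))
    simp only [hg, smul_eq_mul] at this ⊢
    rw [hu'] at this ⊢
    exact this
  have cf := conc_of g a b gc
  have g0 : 0 < g 0 := by
    by_contra! h
    have h0 : g 0 = 0 := le_antisymm h (gnn 0)
    have : F = 0 := by
      funext x
      by_cases hx : x ∈ Icc a b
      · rw [← gF]
        have : g x = 0 := by
          rcases le_total x 0 with h1 | h1
          · have := cf x b 0 hx.1 h1 b0.le le_rfl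
            rw [h0] at this
            nlinarith [gnn x, gnn b, mul_nonneg (by linarith : 0 ≤ 0 - x) (gnn b)]
          · have := cf a x 0 le_rfl a0.le h1 hx.2
            rw [h0] at this
            nlinarith [gnn x, gnn a, mul_nonneg (by linarith : 0 ≤ x - 0) (gnn a)]
        rw [this, zero_pow hk0]; rfl
      · exact Fz x hx
    rw [this] at F1
    simp at F1
  have Fp : ∀ x ∈ Ioo 0 b, 0 < F x := by
    intro x hx
    rw [← gF]
    apply pow_pos
    have := cf 0 b x a0.le hx.1.le hx.2.le le_rfl
    have h1 : 0 < (b - x) * g 0 := mul_pos (by linarith [hx.2]) g0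
    have h2 : 0 ≤ (x - 0) * g b := mul_nonneg (by linarith [hx.1]) (gnn b)
    by_contra! h
    have : (b - 0) * g x ≤ 0 := mul_nonpos_of_nonneg_of_nonpos (by linarith) h
    linarith
  set V := ∫ x in (0:ℝ)..b, F x with hVdef
  have V0 : 0 < V := intervalIntegral.intervalIntegral_pos_of_pos_on Fi.intervalIntegrable Fp b0
  have V1 : V ≤ 1 := by
    have : 0 ≤ ∫ x in a..0, F x := intervalIntegral.integral_nonneg a0.le (fun x _ => Fn x)
    linarith
  have F0 : 0 < F 0 := by rw [← gF]; positivity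
  have hF0 : (volume {y : EuclideanSpace ℝ (Fin k) | ((0:ℝ), y) ∈ K}).toReal = F 0 := rfl
  rw [hF0] at hb' ha'
  set p := V ^ (((k + 1 : ℕ):ℝ)⁻¹) with hp
  have p0 : 0 < p := Real.rpow_pos_of_pos V0 _
  have p1 : p ≤ 1 := Real.rpow_le_one V0.le V1 (by positivity)
  have pV : p ^ (k + 1) = V := Real.rpow_inv_natCast_pow V0.le (by omega)
  have hd' : d = p - ((k:ℝ) + 1) / (k + 2) := by
    rw [hd, Real.pow_rpow_inv_natCast (by positivity) (by omega)]
    push_cast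
    ring
  have b'0 : 0 < b' := by rw [hb']; positivity
  have hFb : F 0 * b' = (k + 1) * V := by
    rw [hb']; push_cast; field_simp
  have ha'' : a' = b' - b' / p := by
    rw [ha']
    congr 1
    have : ((k + 1 : ℕ):ℝ) * b' ^ k / F 0 = (b' / p) ^ (k + 1) := by
      rw [div_pow, pV, div_eq_div_iff F0.ne' V0.ne']
      push_cast
      rw [pow_succ]
      linear_combination (-b' ^ k) * hFb
    rw [this, Real.pow_rpow_inv_natCast (by positivity) (by omega)]
  have a'0 : a' ≤ 0 := by
    rw [ha'', sub_nonpos, le_div_iff₀ p0]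
    nlinarith
  have hFg : (fun x => g x ^ k) = F := funext gF
  obtain ⟨hbb, h8, hE⟩ := core k hk a b a0 b0 g gc gnn (fun α β => by rw [hFg]; exact Fi.intervalIntegrable)
    g0 V (by simp only [gF]; rfl) (by simp only [gF]; exact hV') (by simp only [gF]; exact hM)
    b' p (by rw [gF]; exact hFb) p0 pV
  have hA : Convex ℝ {y : EuclideanSpace ℝ (Fin k) | ((0:ℝ), y) ∈ K} := by
    intro y hy z hz u v hu hv huv
    have := hKconv (show ((0:ℝ), y) ∈ K from hy) (show ((0:ℝ), z) ∈ K from hz) hu hv huv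
    simpa using this
  have hcc : ∀ x, c x ^ k = if x ∈ Icc a' b' then F 0 * (1 - x / b') ^ k else 0 := by
    intro x
    rw [hc]
    split_ifs
    · rw [← gF, ← mul_pow]; congr 1; field_simp
    · exact zero_pow hk0
  have hss : ∀ x, s x ^ k = if x ∈ Icc a' b then F 0 * (1 - x / b) ^ k else 0 := by
    intro x
    rw [hs, Real.rpow_inv_natCast_pow ENNReal.toReal_nonneg hk0, hC,
      cone_sec k _ hA (ne 0 ⟨a0.le, b0.le⟩) a' b (by linarith) b0]
    split_ifs with hx
    · have hr : 0 ≤ (b - x) / b := div_nonneg (by linarith [hx.2]) b0.le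
      have e : (fun y : EuclideanSpace ℝ (Fin k) => β + ((b - x) / b) • (y - β))
          = fun y => (β - ((b - x) / b) • β) + ((b - x) / b) • y := by
        funext y; module
      rw [e, vol_affine k _ hr, ENNReal.toReal_mul, ENNReal.toReal_ofReal (by positivity), hF0, mul_comm]
      congr 2
      field_simp
    · simp
  rw [int_abs k hk (F 0) a' b b' F0.le a'0 b0 hbb (fun x => c x ^ k) (fun x => s x ^ k) hcc hss,
    alg k (F 0) a' b b' p V b0 b'0 p0 hFb pV ha'']
  have := final_est k hk b b' p d b0 hbb h8 p0 p1 hE hd'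
  push_cast
  exact this


theorem integral_c_minus_s_bound (n : ℕ) (hn : 2 ≤ n)
    (K : Set (ℝ × EuclideanSpace ℝ (Fin (n - 1))))
    (hKcomp : IsCompact K) (hKconv : Convex ℝ K)
    -- (H1): the centroid of K is the origin
    (hH1 : (∫ p in K, p) = 0)
    -- (H3): max_x |K_x| = 1
    (hH3le : ∀ x : ℝ, volume {y : EuclideanSpace ℝ (Fin (n - 1)) | (x, y) ∈ K} ≤ 1)
    (hH3eq : ∃ x : ℝ, volume {y : EuclideanSpace ℝ (Fin (n - 1)) | (x, y) ∈ K} = 1)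
    -- (H4): |K| = 1
    (hH4 : volume K = 1)
    (a b : ℝ)
    (ha : IsLeast (Prod.fst '' K) a) (hb : IsGreatest (Prod.fst '' K) b)
    (a' b' : ℝ)
    (hb' : b' = ((n:ℝ) / (volume {y : EuclideanSpace ℝ (Fin (n - 1)) | ((0:ℝ), y) ∈ K}).toReal)
            * (volume (K ∩ {p : ℝ × EuclideanSpace ℝ (Fin (n - 1)) | 0 ≤ p.1})).toReal)
    (ha' : a' = b' - (((n:ℝ) * b' ^ (n - 1))
            / (volume {y : EuclideanSpace ℝ (Fin (n - 1)) | ((0:ℝ), y) ∈ K}).toReal)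
              ^ ((n:ℝ)⁻¹))
    (β : EuclideanSpace ℝ (Fin (n - 1))) (hβ : (b, β) ∈ K)
    (C : Set (ℝ × EuclideanSpace ℝ (Fin (n - 1))))
    (hC : C = convexHull ℝ
      ((({a'} : Set ℝ) ×ˢ
          ((fun y => β + ((b - a') / b) • (y - β)) ''
            {y : EuclideanSpace ℝ (Fin (n - 1)) | ((0:ℝ), y) ∈ K}))
        ∪ {(b, β)}))
    (g : ℝ → ℝ)
    (hg : ∀ x, g x = (volume {y : EuclideanSpace ℝ (Fin (n - 1)) | (x, y) ∈ K}).toReal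
              ^ (((n:ℝ) - 1)⁻¹))
    (s : ℝ → ℝ)
    (hs : ∀ x, s x = (volume {y : EuclideanSpace ℝ (Fin (n - 1)) | (x, y) ∈ C}).toReal
              ^ (((n:ℝ) - 1)⁻¹))
    (c : ℝ → ℝ)
    (hc : ∀ x, c x = if x ∈ Icc a' b' then g 0 * (b' - x) / b' else 0)
    (d : ℝ)
    (hd : d = (volume (K ∩ {p : ℝ × EuclideanSpace ℝ (Fin (n - 1)) | 0 ≤ p.1})).toReal ^ ((n:ℝ)⁻¹)
            - (((n:ℝ) / (n + 1)) ^ n) ^ ((n:ℝ)⁻¹)) :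
    (∫ x, |c x ^ (n - 1) - s x ^ (n - 1)|) ≤
      64 * (3:ℝ) ^ (n + 2) * (n:ℝ) ^ (n + 2) * d ^ ((1:ℝ) / (2 * n)) := by
  obtain ⟨k, rfl⟩ : ∃ k, n = k + 1 := ⟨n - 1, by omega⟩
  exact main' k (by omega) K hKcomp hKconv hH1 hH4 a b ha hb a' b' hb' ha' β C hC g hg s hs c hc d hd
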